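/- Let q ≥ 3 be a prime power, F a finite field with q^2 elements, and G ∈ F[x_0,...,x_4] a nonzero homogeneous polynomial of degree 3. If some hyperplane of ℙ^4(F) is contained in V(G)(F), then |V(G)(F) ∩ V_3| ≤ 3(q^5 + q^2) + q^3 + 1. -/

import Mathlib

open MvPolynomial

noncomputable section

/-- The projective space ℙ⁴(F): 1-dimensional F-linear subspaces of F⁵. -/
abbrev P4 (F : Type) [Field F] := Projectivization F (Fin 5 → F)

/-- The non-degenerate Hermitian threefold
    V₃ = {[x] ∈ ℙ⁴(F) : x₀^{q+1} + ⋯ + x₄^{q+1} = 0}. -/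
def hermV3 (q : ℕ) (F : Type) [Field F] : Set (P4 F) :=
  {x | ∑ i, x.rep i ^ (q + 1) = 0}

/-- V(G)(F) = {[x] ∈ ℙ⁴(F) : G(x) = 0}, for G homogeneous this is well defined. -/
def VG {F : Type} [Field F] (G : MvPolynomial (Fin 5) F) : Set (P4 F) :=
  {x | eval x.rep G = 0}

/-- The set of points of ℙ⁴(F) contained in an F-linear subspace of F⁵ of dimension k. -/
def IsLinSub (F : Type) [Field F] (k : ℕ) (S : Set (P4 F)) : Prop :=
  ∃ W : Submodule F (Fin 5 → F), Module.finrank F W = k ∧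
    S = {x : P4 F | x.submodule ≤ W}

/-- A line of ℙ⁴(F). -/
def IsLine (F : Type) [Field F] (S : Set (P4 F)) : Prop := IsLinSub F 2 S

/-- A plane of ℙ⁴(F). -/
def IsPlane (F : Type) [Field F] (S : Set (P4 F)) : Prop := IsLinSub F 3 S

/-- A hyperplane of ℙ⁴(F). -/
def IsHyperplane (F : Type) [Field F] (S : Set (P4 F)) : Prop := IsLinSub F 4 S

/-- The tangent hyperplane T_P(V₃) = {[x] : a₀^q x₀ + ⋯ + a₄^q x₄ = 0} where P = [a]. -/
def tangentHyp (q : ℕ) {F : Type} [Field F] (P : P4 F) : Set (P4 F) :=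
  {x | ∑ i, P.rep i ^ q * x.rep i = 0}

/-- A subset of ℙ⁴(F) is a tangent hyperplane to V₃ if it equals T_P(V₃) for some P ∈ V₃. -/
def IsTangentHyp (q : ℕ) {F : Type} [Field F] (S : Set (P4 F)) : Prop :=
  ∃ P ∈ hermV3 q F, S = tangentHyp q P

open Finset in
open scoped Classical in
/-- A map with fibres of size at most `m` over a set of size at most `n`, from a set of size
`m * n`, has all fibres of size exactly `m`. -/
lemma card_fiber_eq_of_card_eq_mul {A B : Type} (s : Finset A) (t : Finset B) (f : A → B) {m n : ℕ}
    (hs : s.card = m * n) (ht : t.card ≤ n) (hf : ∀ a ∈ s, f a ∈ t)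
    (hm : ∀ b ∈ t, #{a ∈ s | f a = b} ≤ m) : ∀ b ∈ t, #{a ∈ s | f a = b} = m := by
  have h1 : s.card = ∑ b ∈ t, #{a ∈ s | f a = b} := card_eq_sum_card_fiberwise hf
  refine (sum_eq_sum_iff_of_le hm).1 (le_antisymm (sum_le_sum hm) ?_)
  rw [← h1, hs, sum_const, smul_eq_mul, mul_comm]
  exact Nat.mul_le_mul_left _ ht

open Finset in
/-- Averaging a count over translates. -/
lemma card_mul_card_filter_eq_sum {T V : Type} [Fintype T] [Fintype V] [AddCommGroup V]
    (e : T → V) (P : V → Prop) [DecidablePred P] :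
    Fintype.card T * #{x | P x} = ∑ x, #{t | P (x + e t)} := by
  simp_rw [card_filter]
  rw [sum_comm]
  have (t : T) : ∑ x, (if P (x + e t) then 1 else 0) = ∑ x, if P x then 1 else 0 :=
    Equiv.sum_comp (Equiv.addRight (e t)) fun x => if P x then 1 else 0
  simp [this]

section Field

variable {F : Type} [Field F]

open Finset in
open scoped Classical in
lemma card_filter_eval_eq_zero_le [Fintype F] {p : Polynomial F} (hp : p ≠ 0) :
    #{x | p.eval x = 0} ≤ p.natDegree := by
  refine le_trans ?_ p.card_roots'
  refine le_trans (card_le_card ?_) (Multiset.toFinset_card_le _)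
  intro x hx
  simpa [hp] using hx

lemma exists_eq_prime_pow {q : ℕ} (hq : IsPrimePow q) [Fintype F] (hF : Fintype.card F = q ^ 2) :
    ∃ p n : ℕ, ExpChar F p ∧ q = p ^ n := by
  obtain ⟨p, n, hp, -, rfl⟩ := hq
  obtain ⟨p', hc, m, hp', hm⟩ := FiniteField.card' F
  have : p' = p := by
    have h : p' ∣ (p ^ n) ^ 2 := by rw [← hF, hm]; exact dvd_pow_self _ m.ne_zero
    exact (Nat.prime_dvd_prime_iff_eq hp' hp.nat_prime).1
      (hp'.dvd_of_dvd_pow (hp'.dvd_of_dvd_pow h))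
  subst this
  exact ⟨p', n, @ExpChar.prime F _ p' hp' hc, rfl⟩

lemma add_pow_q {q : ℕ} (hq : IsPrimePow q) [Fintype F] (hF : Fintype.card F = q ^ 2) (x y : F) :
    (x + y) ^ q = x ^ q + y ^ q := by
  obtain ⟨p, n, hp, rfl⟩ := exists_eq_prime_pow hq hF
  exact add_pow_expChar_pow x y p n

lemma neg_pow_q {q : ℕ} (hq : IsPrimePow q) [Fintype F] (hF : Fintype.card F = q ^ 2) (x : F) :
    (-x) ^ q = -x ^ q := by
  have h := add_pow_q hq hF x (-x)
  rw [add_neg_cancel, zero_pow hq.ne_zero] at h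
  exact (neg_eq_of_add_eq_zero_right h.symm).symm

lemma pow_q_pow_q {q : ℕ} [Fintype F] (hF : Fintype.card F = q ^ 2) (x : F) :
    (x ^ q) ^ q = x := by
  rw [← pow_mul, ← sq, ← hF, FiniteField.pow_card]

open Finset in
open scoped Classical in
lemma card_filter_pow_q_eq_self_le {q : ℕ} (hq : IsPrimePow q) [Fintype F] :
    #{x : F | x ^ q = x} ≤ q := by
  have h1 := hq.one_lt
  have hd := FiniteField.X_pow_card_sub_X_natDegree_eq F h1
  have := card_filter_eval_eq_zero_le (FiniteField.X_pow_card_sub_X_ne_zero F h1)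
  simpa [hd, sub_eq_zero] using this

open Finset in
open scoped Classical in
lemma card_filter_trace_le {q : ℕ} (hq : IsPrimePow q) [Fintype F] (b : F) :
    #{x : F | x + x ^ q = b} ≤ q := by
  have h1 := hq.one_lt
  have hd : (Polynomial.X ^ q + (Polynomial.X - Polynomial.C b)).natDegree = q := by
    rw [Polynomial.natDegree_add_eq_left_of_natDegree_lt] <;> simp [h1]
  have h0 : Polynomial.X ^ q + (Polynomial.X - Polynomial.C b) ≠ 0 := by
    intro h; rw [h] at hd; simp at hd; omega
  have := card_filter_eval_eq_zero_le h0
  rw [hd] at this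
  convert this using 3 with x
  simp only [Polynomial.eval_add, Polynomial.eval_pow, Polynomial.eval_X, Polynomial.eval_sub,
    Polynomial.eval_C]
  grind

open Finset in
open scoped Classical in
/-- The fibres of the relative trace `x ↦ x + x ^ q` have `q` elements. -/
lemma card_filter_trace_eq {q : ℕ} (hq : IsPrimePow q) [Fintype F] (hF : Fintype.card F = q ^ 2)
    {b : F} (hb : b ^ q = b) : #{x : F | x + x ^ q = b} = q := by
  refine card_fiber_eq_of_card_eq_mul univ {x : F | x ^ q = x} (fun x => x + x ^ q)
    (by rw [card_univ, hF, sq]) (card_filter_pow_q_eq_self_le hq) ?_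
    (fun b _ => card_filter_trace_le hq b) b (by simpa using hb)
  intro a _
  simp [add_pow_q hq hF, pow_q_pow_q hF, add_comm]

open Finset in
open scoped Classical in
lemma card_filter_mul_trace_eq {q : ℕ} (hq : IsPrimePow q) [Fintype F]
    (hF : Fintype.card F = q ^ 2) {b c : F} (hb : b ^ q = b) (hc : c ≠ 0) :
    #{x : F | b + (x * c + (x * c) ^ q) = 0} = q := by
  refine Eq.trans ?_ (card_filter_trace_eq hq hF (b := -b) (by rw [neg_pow_q hq hF, hb]))
  refine card_nbij' (· * c) (· * c⁻¹) ?_ ?_ ?_ ?_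
  · intro x hx
    simp only [coe_filter, mem_univ, true_and, Set.mem_ofPred_eq] at hx ⊢
    linear_combination hx
  · intro x hx
    simp only [coe_filter, mem_univ, true_and, Set.mem_ofPred_eq] at hx ⊢
    rw [inv_mul_cancel_right₀ hc]
    linear_combination hx
  · intro x _; simp [hc]
  · intro x _; simp [hc]

open Finset in
open scoped Classical in
lemma card_filter_norm_eq {q : ℕ} (hq : IsPrimePow q) [Fintype F] (hF : Fintype.card F = q ^ 2)
    {b : F} (hb : b ^ q = b) (hb0 : b ≠ 0) : #{x : F | x ^ (q + 1) = b} = q + 1 := by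
  have h1 := hq.one_lt
  have key := card_fiber_eq_of_card_eq_mul ({x : F | x ≠ 0} : Finset F)
    ({x : F | x ≠ 0 ∧ x ^ q = x} : Finset F) (fun x => x ^ (q + 1)) (m := q + 1) (n := q - 1)
    ?_ ?_ ?_ ?_ b (by simp [hb, hb0])
  · refine Eq.trans ?_ key
    rw [filter_filter]
    congr 1
    ext x
    simp only [mem_filter, mem_univ, true_and]
    constructor
    · rintro rfl; exact ⟨by rintro rfl; simp at hb0, rfl⟩
    · exact fun h => h.2
  · rw [filter_ne', card_erase_of_mem (mem_univ _), card_univ, hF]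
    obtain ⟨k, rfl⟩ : ∃ k, q = k + 1 := ⟨q - 1, by omega⟩
    rw [Nat.add_sub_cancel, Nat.sub_eq_iff_eq_add (Nat.one_le_pow _ _ (by omega))]
    ring
  · have h2 := card_filter_pow_q_eq_self_le (F := F) hq
    have h3 : ({x : F | x ≠ 0 ∧ x ^ q = x} : Finset F) =
        ({x : F | x ^ q = x} : Finset F).erase 0 := by
      ext x; simp
    rw [h3, card_erase_of_mem (by simp; omega)]
    omega
  · intro a ha
    have ha : a ≠ 0 := by simpa using ha
    simp [ha, pow_succ, mul_pow, pow_q_pow_q hF, mul_comm]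
  · intro b _
    have hd : (Polynomial.X ^ (q + 1) - Polynomial.C b).natDegree = q + 1 :=
      Polynomial.natDegree_X_pow_sub_C
    have h0 : Polynomial.X ^ (q + 1) - Polynomial.C b ≠ 0 := by
      intro h; rw [h] at hd; simp at hd
    have := card_filter_eval_eq_zero_le h0
    rw [hd] at this
    refine le_trans (card_le_card ?_) this
    intro x; simp +contextual [sub_eq_zero]

end Field

section LinearCount

variable {F : Type} [Field F] {V : Type} [AddCommGroup V] [Module F V]

open Finset in
open scoped Classical in
lemma card_filter_eq_sum_ker [Fintype F] [Fintype V] (φ : V →ₗ[F] F) {w : V} (hw : φ w ≠ 0)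
    (P : V → Prop) [DecidablePred P] :
    #{x | P x} = ∑ u with φ u = 0, #{s : F | P (u + s • w)} := by
  rw [← card_sigma]
  refine card_nbij' (fun x => ⟨x - (φ x / φ w) • w, φ x / φ w⟩) (fun u => u.1 + u.2 • w) ?_ ?_ ?_ ?_
  · intro x hx
    simpa [hw] using hx
  · rintro ⟨u, s⟩ hu
    have : φ u = 0 ∧ P (u + s • w) := by simpa using hu
    simpa using this.2
  · intro x _
    simp
  · rintro ⟨u, s⟩ hu
    have : φ u = 0 ∧ P (u + s • w) := by simpa using hu
    simp [this.1, hw]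

open Finset in
open scoped Classical in
lemma card_filter_eq_card_mul [Fintype F] [Fintype V] (φ : V →ₗ[F] F) {w : V} (hw : φ w ≠ 0)
    {P : V → Prop} [DecidablePred P] (hP : ∀ x (s : F), P (x + s • w) ↔ P x) :
    #{x | P x} = Fintype.card F * #{x | P x ∧ φ x = 0} := by
  rw [card_filter_eq_sum_ker φ hw, mul_comm, ← smul_eq_mul, ← sum_const]
  have (u : V) : #{s : F | P (u + s • w)} = if P u then Fintype.card F else 0 := by
    simp_rw [hP]
    split_ifs with h <;> simp [h]
  simp_rw [this]
  rw [← sum_filter, filter_filter]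
  simp_rw [and_comm]

open Finset in
open scoped Classical in
lemma card_pow_mul_card_filter_forall_eq_zero [Fintype F] [Fintype V] {k : ℕ}
    (L : Fin k → V →ₗ[F] F) (hL : LinearIndependent F L) :
    Fintype.card F ^ k * #{x | ∀ i, L i x = 0} = Fintype.card V := by
  induction k with
  | zero => simp
  | succ k ih =>
    obtain ⟨h1, h2⟩ := linearIndependent_finSucc.1 hL
    rw [← ih _ h1]
    obtain ⟨w, hw, hw0⟩ : ∃ w, (∀ i, Fin.tail L i w = 0) ∧ L 0 w ≠ 0 := by
      by_contra! h
      refine h2 (mem_span_of_iInf_ker_le_ker fun x hx => h x ?_)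
      simpa using hx
    rw [card_filter_eq_card_mul (L 0) hw0 (P := fun x => ∀ i, Fin.tail L i x = 0)]
    · simp_rw [Fin.forall_fin_succ (P := fun i => L i _ = 0), and_comm, pow_succ, mul_assoc]
      rfl
    · intro x s
      simp [hw]

end LinearCount

section Hermitian

variable {F : Type} [Field F] {q : ℕ}

/-- The Hermitian form `∑ i, x i ^ q * y i`, linear in the second argument. -/
def herm (q : ℕ) (x : Fin 5 → F) : (Fin 5 → F) →ₗ[F] F := ∑ i, x i ^ q • LinearMap.proj i

lemma herm_apply (x y : Fin 5 → F) : herm q x y = ∑ i, x i ^ q * y i := by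
  simp [herm]

lemma herm_self (x : Fin 5 → F) : herm q x x = ∑ i, x i ^ (q + 1) := by
  simp [herm_apply, pow_succ]

lemma herm_smul_left (c : F) (x y : Fin 5 → F) : herm q (c • x) y = c ^ q * herm q x y := by
  simp [herm_apply, mul_pow, Finset.mul_sum, mul_assoc]

lemma herm_smul_smul (c : F) (x : Fin 5 → F) :
    herm q (c • x) (c • x) = c ^ (q + 1) * herm q x x := by
  rw [herm_smul_left, map_smul, smul_eq_mul, pow_succ, mul_assoc]

lemma eq_zero_of_herm_eq_zero (hq : IsPrimePow q) {x : Fin 5 → F} (h : herm q x = 0) : x = 0 := by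
  funext i
  have := LinearMap.congr_fun h (Pi.single i 1)
  simpa [herm_apply, Pi.single_apply, hq.ne_zero] using this

open Finset in
open scoped Classical in
lemma card_filter_and_ne_add {V : Type} [Fintype V] (P R : V → Prop) [DecidablePred P]
    [DecidablePred R] (f : V → F) :
    #{x | P x ∧ f x ≠ 0 ∧ R x} + #{x | P x ∧ f x = 0 ∧ R x} = #{x | P x ∧ R x} := by
  rw [add_comm, ← card_filter_add_card_filter_not (s := {x | P x ∧ R x}) (fun x => f x = 0),
    filter_filter, filter_filter]
  simp_rw [and_assoc, and_comm]

lemma linearIndependent_of_herm_eq_zero {a b : Fin 5 → F} (ha : herm q a a ≠ 0) (hb : b ≠ 0)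
    (hab : herm q a b = 0) : LinearIndependent F ![a, b] := by
  rw [LinearIndependent.pair_iff]
  intro s t h
  have hs : s = 0 := by simpa [hab, ha] using congrArg (herm q a) h
  exact ⟨hs, by simpa [hs, hb] using h⟩

variable [Fintype F]

lemma sum_pow_q (hq : IsPrimePow q) (hF : Fintype.card F = q ^ 2) {ι : Type} [Fintype ι]
    (f : ι → F) : (∑ i, f i) ^ q = ∑ i, f i ^ q :=
  map_sum (AddMonoidHom.mk' (fun x : F => x ^ q) (add_pow_q hq hF)) f Finset.univ

lemma herm_conj (hq : IsPrimePow q) (hF : Fintype.card F = q ^ 2) (x y : Fin 5 → F) :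
    herm q x y ^ q = herm q y x := by
  simp [herm_apply, sum_pow_q hq hF, mul_pow, pow_q_pow_q hF, mul_comm]

lemma herm_eq_zero_comm (hq : IsPrimePow q) (hF : Fintype.card F = q ^ 2) {x y : Fin 5 → F} :
    herm q x y = 0 ↔ herm q y x = 0 := by
  rw [← herm_conj hq hF x y, pow_eq_zero_iff hq.ne_zero]

lemma herm_add_left (hq : IsPrimePow q) (hF : Fintype.card F = q ^ 2) (x y z : Fin 5 → F) :
    herm q (x + y) z = herm q x z + herm q y z := by
  simp [herm_apply, add_pow_q hq hF, add_mul, Finset.sum_add_distrib]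

lemma herm_add_smul_self (hq : IsPrimePow q) (hF : Fintype.card F = q ^ 2) (x y : Fin 5 → F)
    (s : F) : herm q (x + s • y) (x + s • y) =
      herm q x x + (s * herm q x y + (s * herm q x y) ^ q) + s ^ (q + 1) * herm q y y := by
  rw [herm_add_left hq hF, map_add, map_add, herm_smul_left, herm_smul_smul, map_smul, mul_pow,
    herm_conj hq hF, smul_eq_mul]
  ring

lemma herm_sum_left (hq : IsPrimePow q) (hF : Fintype.card F = q ^ 2) {ι : Type} [Fintype ι]
    (g : ι → F) (v : ι → Fin 5 → F) (y : Fin 5 → F) :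
    herm q (∑ i, g i • v i) y = ∑ i, g i ^ q * herm q (v i) y := by
  simp_rw [← herm_smul_left]
  exact map_sum (AddMonoidHom.mk' (fun x => herm q x y) fun a b => herm_add_left hq hF a b y) _ _

lemma exists_herm_eq (hF : Fintype.card F = q ^ 2) (φ : (Fin 5 → F) →ₗ[F] F) :
    ∃ a, herm q a = φ := by
  refine ⟨fun i => φ (Pi.single i 1) ^ q, LinearMap.pi_ext' fun i => LinearMap.ext_ring ?_⟩
  simp [herm_apply, pow_q_pow_q hF, Pi.single_apply]

lemma linearIndependent_herm (hq : IsPrimePow q) (hF : Fintype.card F = q ^ 2) {k : ℕ}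
    {v : Fin k → Fin 5 → F} (hv : LinearIndependent F v) :
    LinearIndependent F fun i => herm q (v i) := by
  rw [Fintype.linearIndependent_iff] at hv ⊢
  intro g hg i
  have h0 : herm q (∑ i, g i ^ q • v i) = 0 := by
    ext1 y
    have := LinearMap.congr_fun hg
    refine LinearMap.ext_ring ?_
    simpa [herm_sum_left hq hF, pow_q_pow_q hF] using this (LinearMap.single F (fun _ => F) y 1)
  exact (pow_eq_zero_iff hq.ne_zero).1 (hv _ (eq_zero_of_herm_eq_zero hq h0) i)

open Finset in
open scoped Classical in
lemma card_filter_eq_zero (hq : IsPrimePow q) (hF : Fintype.card F = q ^ 2)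
    {φ : (Fin 5 → F) →ₗ[F] F} (hφ : φ ≠ 0) : #{x | φ x = 0} = q ^ 8 := by
  have h := card_pow_mul_card_filter_forall_eq_zero ![φ] (by simpa using hφ)
  simp only [Fin.forall_fin_one, Matrix.cons_val_zero, Fintype.card_fun, hF, Fintype.card_fin] at h
  have hp : 0 < (q ^ 2) ^ 1 := by have := hq.pos; positivity
  exact Nat.eq_of_mul_eq_mul_left hp (by rw [h]; ring)

open Finset in
open scoped Classical in
lemma card_filter_eq_zero_and (hq : IsPrimePow q) (hF : Fintype.card F = q ^ 2)
    {φ ψ : (Fin 5 → F) →ₗ[F] F} (h : LinearIndependent F ![φ, ψ]) :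
    #{x | φ x = 0 ∧ ψ x = 0} = q ^ 6 := by
  have h := card_pow_mul_card_filter_forall_eq_zero _ h
  simp only [Fin.forall_fin_two, Matrix.cons_val_zero, Matrix.cons_val_one, Fintype.card_fun, hF,
    Fintype.card_fin] at h
  have hp : 0 < (q ^ 2) ^ 2 := by have := hq.pos; positivity
  exact Nat.eq_of_mul_eq_mul_left hp (by rw [h]; ring)

lemma linearIndependent_herm_pair (hq : IsPrimePow q) (hF : Fintype.card F = q ^ 2)
    {x y : Fin 5 → F} (h : LinearIndependent F ![x, y]) :
    LinearIndependent F ![herm q x, herm q y] := by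
  convert linearIndependent_herm hq hF h using 1
  funext i
  fin_cases i <;> rfl

open Finset in
open scoped Classical in
lemma card_filter_sum_pow_eq_zero (hq : IsPrimePow q) (hF : Fintype.card F = q ^ 2) (m : ℕ) :
    #{x : Fin (m + 1) → F | ∑ i, x i ^ (q + 1) = 0} + q * #{x : Fin m → F | ∑ i, x i ^ (q + 1) = 0}
      = (q + 1) * q ^ (2 * m) := by
  have h1 : #{x : Fin (m + 1) → F | ∑ i, x i ^ (q + 1) = 0} =
      ∑ u : Fin m → F, #{s : F | s ^ (q + 1) + ∑ i, u i ^ (q + 1) = 0} := by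
    simp_rw [card_filter]
    rw [← (Fin.consEquiv fun _ => F).sum_comp, Fintype.sum_prod_type_right]
    simp [Fin.consEquiv, Fin.sum_univ_succ]
  have h2 (u : Fin m → F) : #{s : F | s ^ (q + 1) + ∑ i, u i ^ (q + 1) = 0} +
      (if ∑ i, u i ^ (q + 1) = 0 then q else 0) = q + 1 := by
    split_ifs with h
    · have : #{s : F | s = 0} = 1 := card_eq_one.2 ⟨0, by ext; simp⟩
      simp [h, this, add_comm]
    · rw [add_zero]
      refine Eq.trans ?_ (card_filter_norm_eq hq hF (b := -∑ i, u i ^ (q + 1)) ?_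
        (by simpa using h))
      · simp_rw [eq_neg_iff_add_eq_zero]
      · rw [neg_pow_q hq hF, sum_pow_q hq hF]
        simp [pow_succ, mul_pow, pow_q_pow_q hF, mul_comm]
  have h3 : q * #{x : Fin m → F | ∑ i, x i ^ (q + 1) = 0} =
      ∑ u : Fin m → F, if ∑ i, u i ^ (q + 1) = 0 then q else 0 := by
    rw [← sum_filter, sum_const, smul_eq_mul, mul_comm]
  rw [h1, h3, ← sum_add_distrib, sum_congr rfl fun u _ => h2 u]
  simp [hF, ← pow_mul, mul_comm]

open Finset in
open scoped Classical in
lemma card_isotropic (hq : IsPrimePow q) (hF : Fintype.card F = q ^ 2) :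
    #{x : Fin 5 → F | herm q x x = 0} + q ^ 5 = q ^ 9 + q ^ 4 := by
  have h := card_filter_sum_pow_eq_zero (F := F) hq hF
  have h0 : #{x : Fin 0 → F | ∑ i, x i ^ (q + 1) = 0} = 1 := by simp
  have e0 := h 0
  have e1 := h 1
  have e2 := h 2
  have e3 := h 3
  have e4 := h 4
  simp_rw [herm_self]
  rw [h0] at e0
  zify at *
  linear_combination e4 - q * e3 + q ^ 2 * e2 - q ^ 3 * e1 + q ^ 4 * e0

open Finset in
open scoped Classical in
lemma card_isotropic_add_perp (hq : IsPrimePow q) (hF : Fintype.card F = q ^ 2) {w : Fin 5 → F}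
    (hw : herm q w w ≠ 0) {P : (Fin 5 → F) → Prop}
    [DecidablePred P] (hP : ∀ x (s : F), P (x + s • w) ↔ P x) :
    #{x | P x ∧ herm q x x = 0} + q * #{x | P x ∧ herm q w x = 0 ∧ herm q x x = 0} =
      (q + 1) * #{x | P x ∧ herm q w x = 0} := by
  rw [card_filter_eq_sum_ker (herm q w) hw]
  have h2 (u : Fin 5 → F) (hu : herm q w u = 0) :
      #{s : F | P (u + s • w) ∧ herm q (u + s • w) (u + s • w) = 0} +
      (if P u ∧ herm q u u = 0 then q else 0) = if P u then q + 1 else 0 := by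
    simp_rw [hP, herm_add_smul_self hq hF, (herm_eq_zero_comm hq hF).1 hu]
    by_cases h : P u
    · by_cases h' : herm q u u = 0
      · have : #{s : F | s = 0} = 1 := card_eq_one.2 ⟨0, by ext; simp⟩
        simp [h, h', hw, hq.ne_zero, this, add_comm]
      · simp only [h, h', true_and, and_false, if_false, if_true, add_zero]
        refine Eq.trans ?_
          (card_filter_norm_eq hq hF (b := -herm q u u / herm q w w) ?_ (by simp [hw, h']))
        · congr 1
          ext s
          rw [mem_filter_univ, mem_filter_univ, eq_div_iff hw]
          simp only [mul_zero, zero_pow hq.ne_zero, add_zero, eq_neg_iff_add_eq_zero]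
          rw [add_comm]
        · rw [div_pow, neg_pow_q hq hF, herm_conj hq hF, herm_conj hq hF]
    · simp [h]
  have h3 : q * #{x | P x ∧ herm q w x = 0 ∧ herm q x x = 0} =
      ∑ u with herm q w u = 0, if P u ∧ herm q u u = 0 then q else 0 := by
    rw [← sum_filter, sum_const, smul_eq_mul, mul_comm, filter_filter]
    simp_rw [and_left_comm]
  rw [h3, ← sum_add_distrib, sum_congr rfl fun u hu => h2 u (by simpa using hu), ← sum_filter,
    sum_const, smul_eq_mul, filter_filter, mul_comm]
  simp_rw [and_comm]

open Finset in
open scoped Classical in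
lemma mul_card_isotropic_not_perp (hq : IsPrimePow q) (hF : Fintype.card F = q ^ 2)
    {a : Fin 5 → F} (ha : herm q a a = 0) {P : (Fin 5 → F) → Prop}
    (hP : ∀ x (s : F), P (x + s • a) ↔ P x) :
    q * #{x | P x ∧ herm q a x ≠ 0 ∧ herm q x x = 0} = #{x | P x ∧ herm q a x ≠ 0} := by
  have h1 := card_mul_card_filter_eq_sum (fun s : F => s • a)
    (fun x => P x ∧ herm q a x ≠ 0 ∧ herm q x x = 0)
  have h2 (x : Fin 5 → F) : #{s : F | P (x + s • a) ∧ herm q a (x + s • a) ≠ 0 ∧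
      herm q (x + s • a) (x + s • a) = 0} = if P x ∧ herm q a x ≠ 0 then q else 0 := by
    simp_rw [hP, herm_add_smul_self hq hF, map_add, map_smul, ha]
    by_cases h : P x ∧ herm q a x ≠ 0
    · rw [if_pos h]
      refine Eq.trans ?_ (card_filter_mul_trace_eq hq hF (herm_conj hq hF x x)
        (mt (herm_eq_zero_comm hq hF).1 h.2))
      simp [h.1, h.2]
    · rw [if_neg h, card_eq_zero, filter_eq_empty_iff]
      simp only [smul_zero, add_zero, ← and_assoc, h, false_and, not_false_eq_true, implies_true]
  simp_rw [h2, hF] at h1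
  rw [← sum_filter, sum_const, smul_eq_mul, mul_comm _ q, sq, mul_assoc] at h1
  exact Nat.eq_of_mul_eq_mul_left hq.pos h1

open Finset in
open scoped Classical in
/-- Isotropic vectors of the polar hyperplane of a non-isotropic vector. -/
lemma card_isotropic_perp_of_ne (hq : IsPrimePow q) (hF : Fintype.card F = q ^ 2)
    {a : Fin 5 → F} (ha : herm q a a ≠ 0) :
    #{x | herm q a x = 0 ∧ herm q x x = 0} + q ^ 3 = q ^ 7 + q ^ 4 := by
  have h1 := card_isotropic_add_perp hq hF ha (P := fun _ => True) (by simp)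
  have h2 := card_isotropic hq hF
  simp only [true_and] at h1
  rw [card_filter_eq_zero hq hF (by rintro h; simp [h] at ha)] at h1
  refine Nat.eq_of_mul_eq_mul_left hq.pos ?_
  zify at *
  linear_combination h1 - h2

open Finset in
open scoped Classical in
/-- Isotropic vectors of a tangent hyperplane. -/
lemma card_isotropic_perp_of_eq (hq : IsPrimePow q) (hF : Fintype.card F = q ^ 2)
    {a : Fin 5 → F} (ha0 : a ≠ 0) (ha : herm q a a = 0) :
    #{x | herm q a x = 0 ∧ herm q x x = 0} + q ^ 5 = q ^ 7 + q ^ 4 := by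
  have h1 := mul_card_isotropic_not_perp hq hF ha (P := fun _ => True) (by simp)
  have h2 := card_isotropic hq hF
  have h3 := card_filter_and_ne_add (fun _ => True) (fun x => herm q x x = 0) (herm q a)
  have h4 := card_filter_and_ne_add (fun _ => True) (fun _ => True) (herm q a)
  simp only [true_and, and_true] at h1 h3 h4
  rw [card_filter_eq_zero hq hF (mt (eq_zero_of_herm_eq_zero hq) ha0)] at h4
  rw [filter_true, card_univ, Fintype.card_fun, hF, Fintype.card_fin] at h4
  refine Nat.eq_of_mul_eq_mul_left hq.pos ?_
  zify at *
  linear_combination q * h3 - h1 + q * h2 - h4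

open Finset in
open scoped Classical in
lemma card_isotropic_hyperplane_le (hq : IsPrimePow q) (hF : Fintype.card F = q ^ 2)
    {φ : (Fin 5 → F) →ₗ[F] F} (hφ : φ ≠ 0) :
    #{x | φ x = 0 ∧ herm q x x = 0} + q ^ 3 ≤ q ^ 7 + q ^ 4 := by
  obtain ⟨a, rfl⟩ := exists_herm_eq hF φ
  by_cases ha : herm q a a = 0
  · have ha0 : a ≠ 0 := by
      rintro rfl
      exact hφ (by ext; simp [herm_apply, hq.ne_zero])
    rw [← card_isotropic_perp_of_eq hq hF ha0 ha]
    have := Nat.pow_le_pow_right hq.pos (show 3 ≤ 5 by norm_num)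
    omega
  · rw [← card_isotropic_perp_of_ne hq hF ha]

open Finset in
open scoped Classical in
lemma card_isotropic_perp_not_perp_le (hq : IsPrimePow q) (hF : Fintype.card F = q ^ 2)
    {a b : Fin 5 → F} (ha : herm q a a ≠ 0) (hab : herm q a b = 0) :
    #{x | herm q a x = 0 ∧ herm q b x ≠ 0 ∧ herm q x x = 0} + (q ^ 5 + q ^ 2) ≤ q ^ 7 + q ^ 4 := by
  have h57 : q ^ 5 ≤ q ^ 7 := Nat.pow_le_pow_right hq.pos (by norm_num)
  have h24 : q ^ 2 ≤ q ^ 4 := Nat.pow_le_pow_right hq.pos (by norm_num)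
  by_cases hb0 : b = 0
  · have h0 : ∀ x, herm q (0 : Fin 5 → F) x = 0 := by simp [herm_apply, hq.ne_zero]
    simp only [hb0, h0, ne_eq, not_true_eq_false, false_and, and_false, filter_false, card_empty]
    omega
  have hli := card_filter_eq_zero_and hq hF
    (linearIndependent_herm_pair hq hF (linearIndependent_of_herm_eq_zero ha hb0 hab))
  have hinv : ∀ x (s : F), herm q a (x + s • b) = 0 ↔ herm q a x = 0 := by simp [hab]
  by_cases hb : herm q b b = 0
  · have h1 := mul_card_isotropic_not_perp hq hF hb (P := fun x => herm q a x = 0) hinv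
    have h2 := card_filter_and_ne_add (fun x => herm q a x = 0) (fun _ => True) (herm q b)
    simp only [and_true] at h2
    rw [hli, card_filter_eq_zero hq hF (by rintro h; simp [h] at ha), ← h1] at h2
    have h3 : #{x | herm q a x = 0 ∧ herm q b x ≠ 0 ∧ herm q x x = 0} + q ^ 5 = q ^ 7 := by
      refine Nat.eq_of_mul_eq_mul_left hq.pos ?_
      linear_combination h2
    omega
  · have h1 := card_isotropic_add_perp hq hF hb (P := fun x => herm q a x = 0) hinv
    have h2 := card_isotropic_perp_of_ne hq hF ha
    have h3 := card_filter_and_ne_add (fun x => herm q a x = 0) (fun x => herm q x x = 0)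
      (herm q b)
    rw [hli] at h1
    refine le_of_eq (Nat.eq_of_mul_eq_mul_left hq.pos ?_)
    zify at *
    linear_combination q * h3 - h1 + (q + 1) * h2

open Finset in
open scoped Classical in
lemma card_isotropic_tangent_not_perp_le (hq : IsPrimePow q) (hF : Fintype.card F = q ^ 2)
    {a b : Fin 5 → F} (ha0 : a ≠ 0) (ha : herm q a a = 0) :
    #{x | herm q a x = 0 ∧ herm q b x ≠ 0 ∧ herm q x x = 0} + (q ^ 5 + q ^ 2) ≤ q ^ 7 + q ^ 4 := by
  have h1 := card_isotropic_perp_of_eq hq hF ha0 ha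
  have h3 := card_filter_and_ne_add (fun x => herm q a x = 0) (fun x => herm q x x = 0) (herm q b)
  suffices q ^ 2 ≤ #{x | herm q a x = 0 ∧ herm q b x = 0 ∧ herm q x x = 0} by omega
  by_cases hab : herm q b a = 0
  · rw [← hF, ← card_univ]
    refine card_le_card_of_injOn (fun s : F => s • a) ?_ (smul_left_injective F ha0).injOn
    intro s _
    simp [ha, hab, herm_smul_left]
  · have h2 := card_filter_eq_card_mul (herm q b) hab
      (P := fun x => herm q a x = 0 ∧ herm q x x = 0) ?_
    · simp only [and_comm (b := herm q b (_ : Fin 5 → F) = 0), hF] at h2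
      simp only [and_left_comm (a := herm q b (_ : Fin 5 → F) = 0)] at h2
      have h4 : #{x | herm q a x = 0 ∧ herm q b x = 0 ∧ herm q x x = 0} + q ^ 3 =
          q ^ 5 + q ^ 2 := by
        refine Nat.eq_of_mul_eq_mul_left (Nat.pow_pos (n := 2) hq.pos) ?_
        zify at *
        linear_combination h1 - h2
      have := Nat.pow_le_pow_right hq.pos (show 3 ≤ 5 by norm_num)
      omega
    · intro x s
      simp only [map_add, map_smul, ha, smul_zero, add_zero]
      refine and_congr_right fun h => ?_
      rw [← map_smul, ← map_add, herm_add_smul_self hq hF, (herm_eq_zero_comm hq hF).1 h, ha]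
      simp [hq.ne_zero]

open Finset in
open scoped Classical in
/-- The affine part of a hyperplane section of the Hermitian threefold. -/
lemma card_isotropic_hyperplane_diff_le (hq : IsPrimePow q) (hF : Fintype.card F = q ^ 2)
    {φ : (Fin 5 → F) →ₗ[F] F} (hφ : φ ≠ 0) (ψ : (Fin 5 → F) →ₗ[F] F) :
    #{x | φ x = 0 ∧ ψ x ≠ 0 ∧ herm q x x = 0} + (q ^ 5 + q ^ 2) ≤ q ^ 7 + q ^ 4 := by
  obtain ⟨a, rfl⟩ := exists_herm_eq hF φ
  obtain ⟨b, rfl⟩ := exists_herm_eq hF ψ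
  by_cases ha : herm q a a = 0
  · refine card_isotropic_tangent_not_perp_le hq hF ?_ ha
    rintro rfl
    exact hφ (by ext; simp [herm_apply, hq.ne_zero])
  · refine le_trans (le_of_eq ?_) (card_isotropic_perp_not_perp_le hq hF ha
      (b := b + (-herm q a b / herm q a a) • a) (by simp [ha]))
    congr 2
    ext x
    simp +contextual [herm_add_left hq hF, herm_smul_left]

end Hermitian

section Quadric

variable {F : Type} [Field F]

lemma quadraticForm_add_smul {V : Type} [AddCommGroup V] [Module F V] (Q : QuadraticForm F V)
    (x y : V) (s : F) :
    Q (x + s • y) = Q x + s * QuadraticMap.polar Q x y + s ^ 2 * Q y := by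
  rw [QuadraticMap.map_add (⇑Q), QuadraticMap.map_smul, QuadraticMap.polar_smul_right]
  simp only [smul_eq_mul]
  ring

variable [Fintype F]

open Finset in
open scoped Classical in
lemma card_filter_quadratic_le_two (a b : F) {c : F} (hc : c ≠ 0) :
    #{s : F | a + s * b + s ^ 2 * c = 0} ≤ 2 := by
  have hd := Polynomial.natDegree_quadratic (b := b) (c := a) hc
  have h0 : Polynomial.C c * Polynomial.X ^ 2 + Polynomial.C b * Polynomial.X + Polynomial.C a
      ≠ 0 := by
    intro h; rw [h] at hd; simp at hd
  refine le_trans (card_le_card ?_) ((card_filter_eval_eq_zero_le h0).trans hd.le)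
  intro s hs
  simp only [mem_filter_univ, Polynomial.eval_add, Polynomial.eval_mul, Polynomial.eval_pow,
    Polynomial.eval_C, Polynomial.eval_X] at hs ⊢
  linear_combination hs

open Finset in
open scoped Classical in
lemma card_filter_linear_le_one {a b : F} (h : ¬ (a = 0 ∧ b = 0)) :
    #{s : F | a + s * b = 0} ≤ 1 := by
  rw [card_le_one]
  intro s hs t ht
  rw [mem_filter_univ] at hs ht
  by_cases hb : b = 0
  · subst hb; simp at hs; simp [hs] at h
  · exact mul_right_cancel₀ hb (by linear_combination hs - ht)

variable {q : ℕ}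

/-- `x` and `y` span a line of the Hermitian threefold. -/
def SpanIsotropicLine (q : ℕ) (x y : Fin 5 → F) : Prop :=
  LinearIndependent F ![x, y] ∧ herm q x x = 0 ∧ herm q y y = 0 ∧ herm q x y = 0

lemma spanIsotropicLine_comm (hq : IsPrimePow q) (hF : Fintype.card F = q ^ 2)
    {x y : Fin 5 → F} : SpanIsotropicLine q x y ↔ SpanIsotropicLine q y x := by
  unfold SpanIsotropicLine
  rw [LinearIndependent.pair_symm_iff, herm_eq_zero_comm hq hF (x := x) (y := y)]
  tauto

lemma spanIsotropicLine_add_smul (hq : IsPrimePow q) (hF : Fintype.card F = q ^ 2)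
    {x y : Fin 5 → F} (s : F) : SpanIsotropicLine q (x + s • y) y ↔ SpanIsotropicLine q x y := by
  unfold SpanIsotropicLine
  rw [LinearIndependent.pair_add_smul_left_iff, herm_add_smul_self hq hF, herm_add_left hq hF,
    herm_smul_left]
  refine and_congr_right fun _ => ?_
  constructor
  · rintro ⟨h1, h2, h3⟩
    have h4 : herm q x y = 0 := by simpa [h2] using h3
    simpa [h2, h4, hq.ne_zero] using h1
  · rintro ⟨h1, h2, h3⟩
    simp [h1, h2, h3, hq.ne_zero]

open Finset in
open scoped Classical in
lemma card_spanIsotropicLine (hq : IsPrimePow q) (hF : Fintype.card F = q ^ 2)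
    {x : Fin 5 → F} (hx0 : x ≠ 0) (hx : herm q x x = 0) :
    #{y | SpanIsotropicLine q x y} + q ^ 2 + q ^ 5 = q ^ 7 + q ^ 4 := by
  rw [← card_isotropic_perp_of_eq hq hF hx0 hx,
    ← card_filter_add_card_filter_not (s := {y | herm q x y = 0 ∧ herm q y y = 0})
      (fun y => LinearIndependent F ![x, y]), filter_filter, filter_filter]
  congr 2
  · congr 1
    ext y
    simp [SpanIsotropicLine, hx]
    tauto
  · rw [← hF, ← card_univ, ← card_image_of_injective univ (smul_left_injective F hx0)]
    congr 1
    ext y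
    simp only [mem_image, mem_univ, true_and, mem_filter,
      LinearIndependent.pair_iff' hx0, not_forall,
      not_not]
    constructor
    · rintro ⟨c, rfl⟩
      exact ⟨by simp [hx, herm_smul_left], c, rfl⟩
    · exact fun h => h.2

open Finset in
open scoped Classical in
/-- Points of the Hermitian threefold on a quadric that contains none of its lines. -/
lemma card_isotropic_quadric_le_of_no_line (hq : IsPrimePow q) (hF : Fintype.card F = q ^ 2)
    (Q : QuadraticForm F (Fin 5 → F))
    (hQ : ∀ x y, SpanIsotropicLine q x y → Q x = 0 → Q y = 0 → QuadraticMap.polar Q x y ≠ 0) :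
    #{x | herm q x x = 0 ∧ Q x = 0} + 2 * q ^ 5 + 2 ≤ 2 * q ^ 7 + 2 * q ^ 2 + 1 := by
  set S : Finset (Fin 5 → F) := {x | x ≠ 0 ∧ herm q x x = 0} with hS
  set Z : Finset (Fin 5 → F) := {x ∈ S | Q x = 0} with hZ
  obtain ⟨c, hc⟩ : ∃ c, c + q ^ 2 + q ^ 5 = q ^ 7 + q ^ 4 := by
    have h57 : q ^ 5 ≤ q ^ 7 := Nat.pow_le_pow_right hq.pos (by norm_num)
    have h24 : q ^ 2 ≤ q ^ 4 := Nat.pow_le_pow_right hq.pos (by norm_num)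
    exact ⟨q ^ 7 + q ^ 4 - (q ^ 2 + q ^ 5), by omega⟩
  have hcard (x) (hx : x ∈ S) : #{y | SpanIsotropicLine q x y} = c := by
    have hx : x ≠ 0 ∧ herm q x x = 0 := by simpa [hS] using hx
    have := card_spanIsotropicLine hq hF hx.1 hx.2
    omega
  have hmem (x y) (h : SpanIsotropicLine q x y) : x ∈ S := by
    have := h.1.ne_zero 0
    simpa [hS, h.2.1] using this
  have hle (y) (hy : y ∈ S) : q ^ 2 * #{x | SpanIsotropicLine q x y ∧ Q x = 0} +
      (if Q y = 0 then c else 0) ≤ 2 * c := by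
    have h1 := card_mul_card_filter_eq_sum (fun s : F => s • y)
      (fun x => SpanIsotropicLine q x y ∧ Q x = 0)
    have h2 (x) : #{s : F | SpanIsotropicLine q (x + s • y) y ∧ Q (x + s • y) = 0} ≤
        if SpanIsotropicLine q x y then (if Q y = 0 then 1 else 2) else 0 := by
      simp_rw [spanIsotropicLine_add_smul hq hF, quadraticForm_add_smul]
      split_ifs with h h'
      · simp only [h, h', true_and, mul_zero, add_zero]
        exact card_filter_linear_le_one fun hh => hQ x y h hh.1 h' hh.2
      · simp only [h, true_and]
        exact card_filter_quadratic_le_two _ _ h'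
      · simp [h]
    have h3 := sum_le_sum fun x (_ : x ∈ univ) => h2 x
    rw [← h1, hF, ← sum_filter, sum_const, smul_eq_mul] at h3
    simp_rw [spanIsotropicLine_comm hq hF (y := y)] at h3
    rw [hcard y hy] at h3
    simp_rw [spanIsotropicLine_comm hq hF (y := y)]
    split_ifs at h3 ⊢ <;> omega
  have hsum : ∑ y ∈ S, #{x | SpanIsotropicLine q x y ∧ Q x = 0} = #Z * c := by
    have : ∀ x ∈ Z, ∑ y ∈ S, (if SpanIsotropicLine q x y then 1 else 0) = c := by
      intro x hx
      rw [← card_filter, ← hcard x (mem_filter.1 hx).1]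
      congr 1
      ext y
      simp only [mem_filter, mem_univ, true_and, and_iff_right_iff_imp]
      exact fun h => hmem y x ((spanIsotropicLine_comm hq hF).1 h)
    rw [← smul_eq_mul, ← sum_const, ← sum_congr rfl this, sum_comm]
    refine sum_congr rfl fun y _ => ?_
    rw [← card_filter]
    congr 1
    ext x
    simp only [hZ, mem_filter, mem_univ, true_and]
    exact ⟨fun h => ⟨⟨hmem x y h.1, h.2⟩, h.1⟩, fun h => ⟨h.2, h.1.2⟩⟩
  have hmain := sum_le_sum hle
  rw [sum_add_distrib, ← mul_sum, hsum, ← sum_filter, sum_const, sum_const, smul_eq_mul,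
    smul_eq_mul] at hmain
  have hc0 : 0 < c := by
    have h57 : q ^ 5 < q ^ 7 := Nat.pow_lt_pow_right hq.one_lt (by norm_num)
    have h24 : q ^ 2 < q ^ 4 := Nat.pow_lt_pow_right hq.one_lt (by norm_num)
    omega
  have hZS : (q ^ 2 + 1) * #Z ≤ 2 * #S := by
    refine Nat.le_of_mul_le_mul_right ?_ hc0
    linarith
  have hSn : #S + 1 + q ^ 5 = q ^ 9 + q ^ 4 := by
    rw [← card_isotropic hq hF,
      ← card_erase_add_one (s := {x | herm q x x = 0}) (a := (0 : Fin 5 → F)) (by simp)]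
    congr 3
    ext x; simp [hS]
  have hZn : #Z + 1 = #{x | herm q x x = 0 ∧ Q x = 0} := by
    rw [← card_erase_add_one (s := {x | herm q x x = 0 ∧ Q x = 0}) (a := (0 : Fin 5 → F))
      (by simp)]
    congr 2
    ext x; simp [hZ, hS, and_assoc]
  rw [← hZn]
  refine le_of_mul_le_mul_left (a := q ^ 2 + 1) ?_ (by omega)
  zify at *
  linear_combination hZS + 2 * hSn

end Quadric

section PlaneFibers

variable {F : Type} [Fintype F]

open Finset in
open scoped Classical in
lemma card_filter_prod_le {P : F × F → Prop} {m : ℕ} (h : ∀ b, #{a | P (a, b)} ≤ m) :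
    #{p | P p} ≤ Fintype.card F * m := by
  rw [card_filter, Fintype.sum_prod_type_right, ← smul_eq_mul, ← card_univ, ← sum_const]
  refine sum_le_sum fun b _ => ?_
  rw [← card_filter]
  exact h b

open Finset in
open scoped Classical in
lemma card_filter_prod_swap (P : F → F → Prop) :
    #{p : F × F | P p.1 p.2} = #{p : F × F | P p.2 p.1} := by
  refine card_equiv (Equiv.prodComm F F) ?_
  simp

variable [Field F] {q : ℕ}

open Finset in
open scoped Classical in
lemma card_filter_prod_linear_le (hF : Fintype.card F = q ^ 2) (r : F) {b₁ b₂ : F}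
    (hb : ¬ (b₁ = 0 ∧ b₂ = 0)) : #{p : F × F | r + (p.1 * b₁ + p.2 * b₂) = 0} ≤ q ^ 2 := by
  have key (b₁ b₂ : F) (hb : b₁ ≠ 0) :
      #{p : F × F | r + (p.1 * b₁ + p.2 * b₂) = 0} ≤ q ^ 2 := by
    refine (card_filter_prod_le (m := 1) fun b => ?_).trans (by rw [hF, mul_one])
    refine le_trans (le_of_eq ?_) (card_filter_linear_le_one (a := r + b * b₂) fun h => hb h.2)
    simp only [add_assoc, add_comm]
  by_cases h : b₁ = 0
  · rw [card_filter_prod_swap fun s t => r + (s * b₁ + t * b₂) = 0]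
    simp_rw [add_comm (_ * b₁)]
    exact key b₂ b₁ fun h' => hb ⟨h, h'⟩
  · exact key b₁ b₂ h

open Finset in
open scoped Classical in
lemma card_filter_prod_trace_le (hq : IsPrimePow q) (hF : Fintype.card F = q ^ 2) (k : F)
    {c₁ c₂ : F} (hc : ¬ (c₁ = 0 ∧ c₂ = 0)) :
    #{p : F × F | k + ((p.1 * c₁ + p.2 * c₂) + (p.1 * c₁ + p.2 * c₂) ^ q) = 0} ≤ q ^ 3 := by
  have key (c₁ c₂ : F) (hc : c₁ ≠ 0) :
      #{p : F × F | k + ((p.1 * c₁ + p.2 * c₂) + (p.1 * c₁ + p.2 * c₂) ^ q) = 0} ≤ q ^ 3 := by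
    refine (card_filter_prod_le (m := q) fun b => ?_).trans (by rw [hF]; exact le_of_eq (by ring))
    refine le_trans (card_le_card_of_injOn (fun a => a * c₁ + b * c₂) ?_ ?_)
      (card_filter_trace_le hq (-k))
    · intro a ha
      simp only [coe_filter, mem_univ, true_and, Set.mem_ofPred_eq] at ha ⊢
      linear_combination ha
    · intro a _ a' _ h
      exact mul_right_cancel₀ hc (add_right_cancel h)
  by_cases h : c₁ = 0
  · rw [card_filter_prod_swap fun s t => k + ((s * c₁ + t * c₂) + (s * c₁ + t * c₂) ^ q) = 0]
    simp_rw [add_comm (_ * c₁)]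
    exact key c₂ c₁ fun h' => hc ⟨h, h'⟩
  · exact key c₁ c₂ h

open Finset in
open scoped Classical in
lemma card_filter_prod_linear_trace_le (hq : IsPrimePow q) (r k : F) {b₁ b₂ c₁ c₂ : F}
    (h : b₁ * c₂ - b₂ * c₁ ≠ 0) :
    #{p : F × F | r + (p.1 * b₁ + p.2 * b₂) = 0 ∧
      k + ((p.1 * c₁ + p.2 * c₂) + (p.1 * c₁ + p.2 * c₂) ^ q) = 0} ≤ q := by
  refine le_trans (card_le_card_of_injOn (fun p => p.1 * c₁ + p.2 * c₂) ?_ ?_)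
    (card_filter_trace_le hq (-k))
  · intro p hp
    simp only [coe_filter, mem_univ, true_and, Set.mem_ofPred_eq] at hp ⊢
    linear_combination hp.2
  · intro p hp p' hp' hpp
    simp only [coe_filter, mem_univ, true_and, Set.mem_ofPred_eq] at hp hp' hpp
    have h1 : (p.1 - p'.1) * (b₁ * c₂ - b₂ * c₁) = 0 := by
      linear_combination c₂ * (hp.1 - hp'.1) - b₂ * hpp
    have h2 : (p.2 - p'.2) * (b₁ * c₂ - b₂ * c₁) = 0 := by
      linear_combination -c₁ * (hp.1 - hp'.1) + b₁ * hpp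
    exact Prod.ext (sub_eq_zero.1 ((mul_eq_zero_iff_right h).1 h1))
      (sub_eq_zero.1 ((mul_eq_zero_iff_right h).1 h2))

open Finset in
open scoped Classical in
/-- The points of a plane lying on a line and on a Hermitian curve, by degeneracy type. -/
lemma card_filter_prod_le_ite (hq : IsPrimePow q) (hF : Fintype.card F = q ^ 2)
    (r k b₁ b₂ c₁ c₂ : F) :
    #{p : F × F | r + (p.1 * b₁ + p.2 * b₂) = 0 ∧
      k + ((p.1 * c₁ + p.2 * c₂) + (p.1 * c₁ + p.2 * c₂) ^ q) = 0} ≤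
    if c₁ = 0 ∧ c₂ = 0 then (if k = 0 then q ^ 4 else 0)
    else if b₁ * c₂ - b₂ * c₁ ≠ 0 then q
    else if b₁ = 0 ∧ b₂ = 0 then (if r = 0 then q ^ 3 else 0)
    else q ^ 2 := by
  split_ifs with hc hk hd hb hr
  · refine (card_le_univ _).trans ?_
    rw [Fintype.card_prod, hF]
    exact le_of_eq (by ring)
  · simp [hc.1, hc.2, hk, hq.ne_zero]
  · exact card_filter_prod_linear_trace_le hq r k hd
  · refine (card_le_card ?_).trans (card_filter_prod_trace_le hq hF k hc)
    exact monotone_filter_right _ fun p _ hp => hp.2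
  · simp [hb.1, hb.2, hr]
  · refine (card_le_card ?_).trans (card_filter_prod_linear_le hF r hb)
    exact monotone_filter_right _ fun p _ hp => hp.1

end PlaneFibers

section QuadricThroughLine

variable {F : Type} [Field F] [Fintype F] {q : ℕ}

open Finset in
open scoped Classical in
/-- The only points of the Hermitian threefold conjugate to a line of it are those of the line. -/
lemma card_isotropic_perp_line_le (hq : IsPrimePow q) (hF : Fintype.card F = q ^ 2)
    {e₁ e₂ : Fin 5 → F} (he : SpanIsotropicLine q e₁ e₂) :
    #{x | (herm q x e₁ = 0 ∧ herm q x e₂ = 0) ∧ herm q x x = 0} ≤ q ^ 4 := by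
  obtain ⟨hli, h1, h2, h12⟩ := he
  have h21 := (herm_eq_zero_comm hq hF).1 h12
  have hle : #(univ.image fun p : F × F => p.1 • e₁ + p.2 • e₂) ≤ q ^ 4 := by
    refine card_image_le.trans ?_
    rw [card_univ, Fintype.card_prod, hF]
    exact le_of_eq (by ring)
  refine (card_le_card fun x hx => ?_).trans hle
  rw [mem_filter_univ] at hx
  obtain ⟨⟨hx1, hx2⟩, hx⟩ := hx
  have h1x := (herm_eq_zero_comm hq hF).1 hx1
  have h2x := (herm_eq_zero_comm hq hF).1 hx2
  by_contra hmem
  have hv : LinearIndependent F ![x, e₁, e₂] := by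
    refine linearIndependent_finCons.2 ⟨hli, fun hspan => hmem ?_⟩
    rw [Matrix.range_cons, Matrix.range_cons, Matrix.range_empty, Set.union_empty,
      Set.singleton_union, Submodule.mem_span_pair] at hspan
    obtain ⟨a, b, hab⟩ := hspan
    exact mem_image.2 ⟨(a, b), mem_univ _, hab⟩
  have hcard := card_pow_mul_card_filter_forall_eq_zero _ (linearIndependent_herm hq hF hv)
  have hsub : (q ^ 2) ^ 3 ≤ #{y | ∀ i, herm q (![x, e₁, e₂] i) y = 0} := by
    rw [← hF, ← Fintype.card_fin 3, ← Fintype.card_fun, ← card_univ]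
    refine card_le_card_of_injOn (fun g : Fin 3 → F => ∑ i, g i • ![x, e₁, e₂] i) ?_ ?_
    · intro g _
      simp [Fin.forall_fin_succ, Fin.sum_univ_succ, *]
    · exact (linearIndependent_iff_injective_fintypeLinearCombination.1 hv).injOn
  rw [hF, Fintype.card_fun, hF, Fintype.card_fin] at hcard
  have h3 := Nat.mul_le_mul_left ((q ^ 2) ^ 3) hsub
  rw [hcard, ← pow_add] at h3
  exact absurd ((Nat.pow_le_pow_iff_right (Nat.one_lt_pow two_ne_zero hq.one_lt)).1 h3)
    (by norm_num)

open Finset in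
open scoped Classical in
lemma card_quadric_hyperplane_le (hq : IsPrimePow q) (hF : Fintype.card F = q ^ 2)
    (Q : QuadraticForm F (Fin 5 → F)) {φ : (Fin 5 → F) →ₗ[F] F} (hφ : φ ≠ 0)
    (hQ : ∃ x, φ x = 0 ∧ Q x ≠ 0) : #{x | φ x = 0 ∧ Q x = 0} ≤ 2 * q ^ 6 := by
  obtain ⟨v, hv, hQv⟩ := hQ
  have h1 := card_mul_card_filter_eq_sum (fun s : F => s • v) (fun x => φ x = 0 ∧ Q x = 0)
  have h2 (x) : #{s : F | φ (x + s • v) = 0 ∧ Q (x + s • v) = 0} ≤ if φ x = 0 then 2 else 0 := by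
    simp only [map_add, map_smul, hv, smul_zero, add_zero, quadraticForm_add_smul]
    split_ifs with h
    · simpa only [h, true_and] using card_filter_quadratic_le_two _ _ hQv
    · simp [h]
  have h3 := sum_le_sum fun x (_ : x ∈ univ) => h2 x
  rw [← h1, hF, ← sum_filter, sum_const, card_filter_eq_zero hq hF hφ, smul_eq_mul] at h3
  refine le_of_mul_le_mul_left (a := q ^ 2) ?_ (Nat.pow_pos hq.pos)
  linarith

open Finset in
open scoped Classical in
lemma card_quadric_le (hq : IsPrimePow q) (hF : Fintype.card F = q ^ 2)
    (Q : QuadraticForm F (Fin 5 → F))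
    (hQ : ∀ φ : (Fin 5 → F) →ₗ[F] F, φ ≠ 0 → ∃ x, φ x = 0 ∧ Q x ≠ 0) :
    #{x | Q x = 0} ≤ q ^ 8 + q ^ 6 := by
  have h68 : q ^ 6 ≤ q ^ 8 := Nat.pow_le_pow_right hq.pos (by norm_num)
  by_cases hsing : ∃ x, Q x = 0 ∧ Q.polarBilin x ≠ 0
  · obtain ⟨x₁, hx₁, hφ⟩ := hsing
    have hxx : Q.polarBilin x₁ x₁ = 0 := by simp [hx₁]
    set φ := Q.polarBilin x₁ with hφdef
    have h0 := card_quadric_hyperplane_le hq hF Q hφ (hQ φ hφ)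
    have h1 := card_mul_card_filter_eq_sum (fun s : F => s • x₁) (fun x => φ x ≠ 0 ∧ Q x = 0)
    have h2 (x) : #{s : F | φ (x + s • x₁) ≠ 0 ∧ Q (x + s • x₁) = 0} ≤
        if φ x ≠ 0 then 1 else 0 := by
      simp only [map_add, map_smul, hxx, smul_zero, add_zero, quadraticForm_add_smul, hx₁,
        mul_zero, QuadraticMap.polar_comm Q x, ← QuadraticMap.polarBilin_apply_apply]
      split_ifs with h
      · simpa only [h, true_and, ne_eq, not_false_eq_true] using
          card_filter_linear_le_one fun h' => h h'.2
      · simp [h]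
    have h3 := sum_le_sum fun x (_ : x ∈ univ) => h2 x
    have h4 := card_filter_add_card_filter_not (s := (univ : Finset (Fin 5 → F))) (fun x => φ x = 0)
    have h5 := card_filter_and_ne_add (fun _ => True) (fun x => Q x = 0) φ
    simp only [true_and] at h5
    rw [← h1, hF, ← sum_filter, sum_const, smul_eq_mul, mul_one] at h3
    rw [card_filter_eq_zero hq hF hφ, card_univ, Fintype.card_fun, hF, Fintype.card_fin] at h4
    have h6 : #{x | φ x ≠ 0 ∧ Q x = 0} + q ^ 6 ≤ q ^ 8 := by
      refine le_of_mul_le_mul_left (a := q ^ 2) ?_ (Nat.pow_pos hq.pos)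
      simp only [ne_eq] at h3 ⊢
      linarith
    omega
  · have hpolar (x y) (hx : Q x = 0) : QuadraticMap.polar Q x y = 0 := by
      by_contra h
      exact hsing ⟨x, hx, fun h' => h (by simpa using LinearMap.congr_fun h' y)⟩
    let Z : Submodule F (Fin 5 → F) :=
      { carrier := {x | Q x = 0}
        zero_mem' := QuadraticMap.map_zero Q
        add_mem' := fun {x y} hx hy => by
          simp only [Set.mem_ofPred_eq] at hx hy ⊢
          rw [QuadraticMap.map_add (⇑Q), hx, hy, hpolar x y hx]; simp
        smul_mem' := fun c x hx => by
          simp only [Set.mem_ofPred_eq] at hx ⊢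
          rw [QuadraticMap.map_smul, hx, smul_zero] }
    have hZ : Z < ⊤ := by
      obtain ⟨x, -, hx⟩ := hQ (LinearMap.proj 0) fun h => by
        simpa using LinearMap.congr_fun h fun _ => 1
      exact lt_top_iff_ne_top.2 fun h => hx (h ▸ Submodule.mem_top : x ∈ Z)
    obtain ⟨φ, hφ, hle⟩ := Submodule.exists_le_ker_of_lt_top Z hZ
    refine le_trans (card_le_card ?_) ((card_quadric_hyperplane_le hq hF Q hφ (hQ φ hφ)).trans
      (by omega))
    exact monotone_filter_right _ fun x _ hx => ⟨hle (show x ∈ Z from hx), hx⟩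

end QuadricThroughLine

section QuadricThroughLine

variable {F : Type} [Field F] [Fintype F] {q : ℕ}

/-- `e₁` and `e₂` span a line contained in the Hermitian threefold and in the quadric `Q`. -/
def SpanCommonLine (q : ℕ) (Q : QuadraticForm F (Fin 5 → F)) (e₁ e₂ : Fin 5 → F) : Prop :=
  SpanIsotropicLine q e₁ e₂ ∧ Q e₁ = 0 ∧ Q e₂ = 0 ∧ QuadraticMap.polar Q e₁ e₂ = 0

/-- `d x = 0` when `x` is conjugate to the same point of the line `e₁e₂` for both forms. -/
def conjDet (q : ℕ) (Q : QuadraticForm F (Fin 5 → F)) (e₁ e₂ x : Fin 5 → F) : F :=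
  Q.polarBilin e₁ x * herm q x e₂ - Q.polarBilin e₂ x * herm q x e₁

open Finset in
open scoped Classical in
/-- Project from a common line: sum over the fibres the number of common points, by type. -/
lemma mul_card_isotropic_quadric_le_sum (hq : IsPrimePow q) (hF : Fintype.card F = q ^ 2)
    {Q : QuadraticForm F (Fin 5 → F)} {e₁ e₂ : Fin 5 → F} (he : SpanCommonLine q Q e₁ e₂) :
    q ^ 4 * #{x | herm q x x = 0 ∧ Q x = 0} ≤ ∑ x,
      if herm q x e₁ = 0 ∧ herm q x e₂ = 0 then (if herm q x x = 0 then q ^ 4 else 0)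
      else if conjDet q Q e₁ e₂ x ≠ 0 then q
      else if Q.polarBilin e₁ x = 0 ∧ Q.polarBilin e₂ x = 0 then (if Q x = 0 then q ^ 3 else 0)
      else q ^ 2 := by
  obtain ⟨⟨-, h1, h2, h12⟩, hQ1, hQ2, hQ12⟩ := he
  have h21 := (herm_eq_zero_comm hq hF).1 h12
  have hcard := card_mul_card_filter_eq_sum (fun p : F × F => p.1 • e₁ + p.2 • e₂)
    (fun x => herm q x x = 0 ∧ Q x = 0)
  rw [Fintype.card_prod, hF, ← pow_add] at hcard
  rw [hcard]
  refine sum_le_sum fun x _ => ?_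
  refine le_trans (le_of_eq ?_) (card_filter_prod_le_ite hq hF (Q x) (herm q x x)
    (Q.polarBilin e₁ x) (Q.polarBilin e₂ x) (herm q x e₁) (herm q x e₂))
  congr 1
  refine filter_congr fun p _ => ?_
  rw [and_comm, ← add_assoc, quadraticForm_add_smul, quadraticForm_add_smul,
    QuadraticMap.polar_add_left, QuadraticMap.polar_smul_left, hQ1, hQ2, hQ12,
    herm_add_smul_self hq hF, herm_add_smul_self hq hF, herm_add_left hq hF, herm_smul_left,
    h1, h2, h12, QuadraticMap.polarBilin_apply_apply, QuadraticMap.polarBilin_apply_apply,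
    QuadraticMap.polar_comm Q x, QuadraticMap.polar_comm Q x]
  simp only [mul_zero, smul_zero, add_zero, add_pow_q hq hF]
  refine and_congr ?_ ?_ <;> apply Eq.congr_left <;> ring

open Finset in
open scoped Classical in
lemma card_conj_eq_zero (hq : IsPrimePow q) (hF : Fintype.card F = q ^ 2) {w : Fin 5 → F}
    (hw : w ≠ 0) : #{x | herm q x w = 0} = q ^ 8 := by
  rw [← card_filter_eq_zero hq hF (φ := herm q w) fun h => hw (eq_zero_of_herm_eq_zero hq h)]
  simp only [herm_eq_zero_comm hq hF (y := w)]

open Finset in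
open scoped Classical in
lemma mul_card_isotropic_quadric_le (hq : IsPrimePow q) (hF : Fintype.card F = q ^ 2)
    {Q : QuadraticForm F (Fin 5 → F)} {e₁ e₂ : Fin 5 → F} (he : SpanCommonLine q Q e₁ e₂) :
    q ^ 4 * #{x | herm q x x = 0 ∧ Q x = 0} ≤ q * #{x | conjDet q Q e₁ e₂ x ≠ 0} +
      q ^ 2 * #{x | ¬ (herm q x e₁ = 0 ∧ herm q x e₂ = 0) ∧ conjDet q Q e₁ e₂ x = 0 ∧
        ¬ (Q.polarBilin e₁ x = 0 ∧ Q.polarBilin e₂ x = 0)} +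
      q ^ 3 * #{x | ¬ (herm q x e₁ = 0 ∧ herm q x e₂ = 0) ∧
        (Q.polarBilin e₁ x = 0 ∧ Q.polarBilin e₂ x = 0) ∧ Q x = 0} + q ^ 8 := by
  have hline := Nat.mul_le_mul_left (q ^ 4) (card_isotropic_perp_line_le hq hF he.1)
  rw [← pow_add] at hline
  refine le_trans ?_ (Nat.add_le_add_left hline _)
  refine (mul_card_isotropic_quadric_le_sum hq hF he).trans ?_
  simp only [card_filter, mul_sum, ← sum_add_distrib]
  refine sum_le_sum fun x _ => ?_
  by_cases hc : herm q x e₁ = 0 ∧ herm q x e₂ = 0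
  · simp [hc]
  · by_cases hd : conjDet q Q e₁ e₂ x = 0
    · by_cases hb : Q.polarBilin e₁ x = 0 ∧ Q.polarBilin e₂ x = 0
      · by_cases hr : Q x = 0 <;> simp only [hc, hd, hb, hr] <;> simp
      · simp only [hc, hd, hb]; simp
    · simp [hc, hd]

lemma line_bound_arith (hq3 : 3 ≤ q) :
    q ^ 11 + 2 * q ^ 10 + 3 * q ^ 9 + 2 * q ^ 6 ≤ 2 * q ^ 11 + q ^ 8 + q ^ 4 := by
  obtain ⟨k, rfl⟩ := Nat.exists_eq_add_of_le hq3
  zify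
  rw [← sub_nonneg]
  ring_nf
  positivity

lemma exists_apply_eq_zero_and_ne (hq : IsPrimePow q) (hF : Fintype.card F = q ^ 2)
    {φ ψ : (Fin 5 → F) →ₗ[F] F} (h : LinearIndependent F ![φ, ψ]) :
    ∃ x, φ x = 0 ∧ ψ x ≠ 0 := by
  classical
  by_contra! hall
  have h1 := card_filter_eq_zero_and hq hF h
  have h2 := card_filter_eq_zero hq hF (h.ne_zero 0)
  rw [Finset.filter_congr fun x _ => and_iff_left_of_imp (hall x)] at h1
  have h3 := h1.symm.trans h2
  exact absurd (Nat.pow_right_injective hq.one_lt h3) (by norm_num)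

open Finset in
open scoped Classical in
lemma card_isotropic_quadric_le_of_dependent (hq : IsPrimePow q) (hq3 : 3 ≤ q)
    (hF : Fintype.card F = q ^ 2)
    {Q : QuadraticForm F (Fin 5 → F)} {e₁ e₂ : Fin 5 → F} (he : SpanCommonLine q Q e₁ e₂)
    (hQ : ∀ φ : (Fin 5 → F) →ₗ[F] F, φ ≠ 0 → ∃ x, φ x = 0 ∧ Q x ≠ 0)
    (hβ : ¬ LinearIndependent F ![Q.polarBilin e₁, Q.polarBilin e₂]) :
    #{x | herm q x x = 0 ∧ Q x = 0} + 2 * q ^ 5 + 2 * q ^ 2 ≤ 2 * q ^ 7 + 2 * q ^ 4 + 1 := by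
  have hmain := mul_card_isotropic_quadric_le hq hF he
  set N₁ := #{x | conjDet q Q e₁ e₂ x ≠ 0} with hN₁
  set N₂ := #{x | ¬ (herm q x e₁ = 0 ∧ herm q x e₂ = 0) ∧ conjDet q Q e₁ e₂ x = 0 ∧
    ¬ (Q.polarBilin e₁ x = 0 ∧ Q.polarBilin e₂ x = 0)} with hN₂
  set N₃ := #{x | ¬ (herm q x e₁ = 0 ∧ herm q x e₂ = 0) ∧
    (Q.polarBilin e₁ x = 0 ∧ Q.polarBilin e₂ x = 0) ∧ Q x = 0} with hN₃
  refine le_of_mul_le_mul_left (a := q ^ 4) ?_ (Nat.pow_pos hq.pos)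
  by_cases h0 : Q.polarBilin e₁ = 0 ∧ Q.polarBilin e₂ = 0
  · have h1 : N₁ = 0 := by simp [hN₁, conjDet, h0.1, h0.2]
    have h2 : N₂ = 0 := by simp [hN₂, h0.1, h0.2]
    have h3 : N₃ ≤ q ^ 8 + q ^ 6 :=
      le_trans (card_le_card (monotone_filter_right _ fun x _ hx => hx.2.2))
        (card_quadric_le hq hF Q hQ)
    rw [h1, h2] at hmain
    have h4 := Nat.mul_le_mul_left (q ^ 3) h3
    have := line_bound_arith hq3
    linarith [Nat.zero_le (q ^ 10)]
  · have h1 : N₁ ≤ q ^ 10 := by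
      refine (card_le_univ _).trans ?_
      rw [Fintype.card_fun, hF, Fintype.card_fin, ← pow_mul]
    have h2 : N₂ ≤ q ^ 8 := by
      rw [LinearIndependent.pair_iff] at hβ
      push Not at hβ
      obtain ⟨s, t, hst, hne⟩ := hβ
      have hw : s • e₁ + t • e₂ ≠ 0 := fun h =>
        hne (LinearIndependent.pair_iff.1 he.1.1 s t h).1
          (LinearIndependent.pair_iff.1 he.1.1 s t h).2
      rw [← card_conj_eq_zero hq hF hw]
      refine card_le_card (monotone_filter_right _ fun x _ ⟨_, hd, hb⟩ => ?_)
      have hstx : s * Q.polarBilin e₁ x + t * Q.polarBilin e₂ x = 0 := LinearMap.congr_fun hst x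
      unfold conjDet at hd
      rw [map_add, map_smul, map_smul, smul_eq_mul, smul_eq_mul]
      rw [not_and_or] at hb
      rcases hb with hb | hb <;> refine (mul_eq_zero_iff_left hb).1 ?_
      · linear_combination t * hd + herm q x e₁ * hstx
      · linear_combination -s * hd + herm q x e₂ * hstx
    have h3 : N₃ ≤ 2 * q ^ 6 := by
      rw [not_and_or] at h0
      rcases h0 with h0 | h0 <;> refine le_trans (card_le_card ?_)
        (card_quadric_hyperplane_le hq hF Q h0 (hQ _ h0))
      · exact monotone_filter_right _ fun x _ hx => ⟨hx.2.1.1, hx.2.2⟩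
      · exact monotone_filter_right _ fun x _ hx => ⟨hx.2.1.2, hx.2.2⟩
    have h1' := Nat.mul_le_mul_left q h1
    have h2' := Nat.mul_le_mul_left (q ^ 2) h2
    have h3' := Nat.mul_le_mul_left (q ^ 3) h3
    have h910 := Nat.pow_le_pow_right hq.pos (show 9 ≤ 10 by norm_num)
    have := line_bound_arith hq3
    linarith

open Finset in
open scoped Classical in
lemma card_isotropic_quadric_le_of_not_ker_le (hq : IsPrimePow q) (hq3 : 3 ≤ q)
    (hF : Fintype.card F = q ^ 2)
    {Q : QuadraticForm F (Fin 5 → F)} {e₁ e₂ : Fin 5 → F} (he : SpanCommonLine q Q e₁ e₂)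
    (hβ : LinearIndependent F ![Q.polarBilin e₁, Q.polarBilin e₂])
    {x₀ : Fin 5 → F} (h₁ : herm q x₀ e₁ = 0) (h₂ : herm q x₀ e₂ = 0)
    (h₀ : ¬ (Q.polarBilin e₁ x₀ = 0 ∧ Q.polarBilin e₂ x₀ = 0)) :
    #{x | herm q x x = 0 ∧ Q x = 0} + 2 * q ^ 5 + 2 * q ^ 2 ≤ 2 * q ^ 7 + 2 * q ^ 4 + 1 := by
  have hmain := mul_card_isotropic_quadric_le hq hF he
  set N₁ := #{x | conjDet q Q e₁ e₂ x ≠ 0} with hN₁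
  set N₂ := #{x | ¬ (herm q x e₁ = 0 ∧ herm q x e₂ = 0) ∧ conjDet q Q e₁ e₂ x = 0 ∧
    ¬ (Q.polarBilin e₁ x = 0 ∧ Q.polarBilin e₂ x = 0)} with hN₂
  set N₃ := #{x | ¬ (herm q x e₁ = 0 ∧ herm q x e₂ = 0) ∧
    (Q.polarBilin e₁ x = 0 ∧ Q.polarBilin e₂ x = 0) ∧ Q x = 0} with hN₃
  have hV : #(univ : Finset (Fin 5 → F)) = q ^ 10 := by
    rw [card_univ, Fintype.card_fun, hF, Fintype.card_fin, ← pow_mul]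
  have h1 : N₁ ≤ q ^ 10 := (card_le_univ _).trans hV.le
  have h2 : N₂ ≤ 2 * q ^ 8 := by
    refine (card_le_card (monotone_filter_right _ fun x _ hx => hx.2.1)).trans ?_
    refine le_of_mul_le_mul_left (a := q ^ 2) ?_ (Nat.pow_pos hq.pos)
    have hw : Q.polarBilin e₁ x₀ • e₂ + (-Q.polarBilin e₂ x₀) • e₁ ≠ 0 := fun h => by
      have := LinearIndependent.pair_iff.1 he.1.1 _ _ ((add_comm _ _).trans h)
      exact h₀ ⟨this.2, neg_eq_zero.1 this.1⟩
    have h3 := card_mul_card_filter_eq_sum (fun s : F => s • x₀) (fun x => conjDet q Q e₁ e₂ x = 0)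
    have h4 (x) : #{s : F | conjDet q Q e₁ e₂ (x + s • x₀) = 0} ≤
        1 + if herm q x (Q.polarBilin e₁ x₀ • e₂ + (-Q.polarBilin e₂ x₀) • e₁) = 0
          then q ^ 2 else 0 := by
      have h5 (s : F) : conjDet q Q e₁ e₂ (x + s • x₀) = conjDet q Q e₁ e₂ x +
          s * herm q x (Q.polarBilin e₁ x₀ • e₂ + (-Q.polarBilin e₂ x₀) • e₁) := by
        simp only [conjDet, herm_add_left hq hF, herm_smul_left, h₁, h₂, map_add, map_smul,
          smul_eq_mul]
        ring
      simp_rw [h5]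
      split_ifs with h
      · refine (card_le_univ _).trans ?_
        rw [hF]; omega
      · exact card_filter_linear_le_one fun h' => h h'.2
    have h5 := sum_le_sum fun x (_ : x ∈ univ) => h4 x
    rw [← h3, hF, sum_add_distrib, ← sum_filter, sum_const, sum_const, hV,
      card_conj_eq_zero hq hF hw, smul_eq_mul, smul_eq_mul] at h5
    linarith
  have h3 : N₃ ≤ q ^ 6 := by
    rw [← card_filter_eq_zero_and hq hF hβ]
    exact card_le_card (monotone_filter_right _ fun x _ hx => hx.2.1)
  have h1' := Nat.mul_le_mul_left q h1
  have h2' := Nat.mul_le_mul_left (q ^ 2) h2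
  have h3' := Nat.mul_le_mul_left (q ^ 3) h3
  refine le_of_mul_le_mul_left (a := q ^ 4) ?_ (Nat.pow_pos hq.pos)
  have := line_bound_arith hq3
  linarith

lemma exists_conjDet_ne_zero (hq : IsPrimePow q) (hF : Fintype.card F = q ^ 2)
    {Q : QuadraticForm F (Fin 5 → F)} {e₁ e₂ : Fin 5 → F} (he : SpanIsotropicLine q e₁ e₂)
    (hβ : LinearIndependent F ![Q.polarBilin e₁, Q.polarBilin e₂])
    (hker : ∀ x, herm q x e₁ = 0 → herm q x e₂ = 0 →
      Q.polarBilin e₁ x = 0 ∧ Q.polarBilin e₂ x = 0) : ∃ y, conjDet q Q e₁ e₂ y ≠ 0 := by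
  by_contra! hd
  have hli := linearIndependent_herm_pair hq hF he.1
  obtain ⟨x, hx₂, hx₁⟩ := exists_apply_eq_zero_and_ne hq hF (LinearIndependent.pair_symm_iff.1 hli)
  obtain ⟨z, hz₁, hz₂⟩ := exists_apply_eq_zero_and_ne hq hF hli
  have cx₂ := (herm_eq_zero_comm hq hF).1 hx₂
  have cz₁ := (herm_eq_zero_comm hq hF).1 hz₁
  have cx₁ : herm q x e₁ ≠ 0 := fun h => hx₁ ((herm_eq_zero_comm hq hF).1 h)
  have cz₂ : herm q z e₂ ≠ 0 := fun h => hz₂ ((herm_eq_zero_comm hq hF).1 h)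
  have hbx₂ : Q.polarBilin e₂ x = 0 := by
    have := hd x
    rw [conjDet, cx₂, mul_zero, zero_sub, neg_eq_zero] at this
    exact (mul_eq_zero_iff_right cx₁).1 this
  have hbz₁ : Q.polarBilin e₁ z = 0 := by
    have := hd z
    rw [conjDet, cz₁, mul_zero, sub_zero] at this
    exact (mul_eq_zero_iff_right cz₂).1 this
  have hpolar (s : F) : s ^ q * (Q.polarBilin e₁ x * herm q z e₂) -
      s * (Q.polarBilin e₂ z * herm q x e₁) = 0 := by
    rw [← hd (x + s • z)]
    simp only [conjDet, herm_add_left hq hF, herm_smul_left, map_add, map_smul, smul_eq_mul,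
      hbx₂, hbz₁, cx₂, cz₁]
    ring
  obtain ⟨s, hs⟩ : ∃ s : F, s ^ q - s ≠ 0 := by
    classical
    by_contra! h
    have h1 := card_filter_pow_q_eq_self_le (F := F) hq
    rw [Finset.filter_true_of_mem fun s _ => sub_eq_zero.1 (h s), Finset.card_univ, hF] at h1
    nlinarith [hq.one_lt]
  have h1 := hpolar 1
  rw [one_pow, one_mul, one_mul] at h1
  have hbx₁ : Q.polarBilin e₁ x = 0 := by
    refine (mul_eq_zero_iff_right (mul_ne_zero hs cz₂)).1 ?_
    linear_combination hpolar s - s * h1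
  have hbz₂ : Q.polarBilin e₂ z = 0 := by
    rw [hbx₁, zero_mul, zero_sub, neg_eq_zero] at h1
    exact (mul_eq_zero_iff_right cx₁).1 h1
  refine hβ.ne_zero 0 (LinearMap.ext fun u => ?_)
  change Q.polarBilin e₁ u = 0
  have hu := (hker (u + (-(herm q e₁ u / herm q e₁ x)) • x + (-(herm q e₂ u / herm q e₂ z)) • z)
    ((herm_eq_zero_comm hq hF).1 (by simp [hx₁, hz₁]))
    ((herm_eq_zero_comm hq hF).1 (by simp [hx₂, hz₂]))).1
  simpa only [map_add, map_smul, hbx₁, hbz₁, smul_zero, add_zero] using hu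

open Finset in
open scoped Classical in
lemma card_filter_semilinear_le (hq : IsPrimePow q) (a b c : F) {d : F} (hd : d ≠ 0) :
    #{s : F | a + s * b + s ^ q * c + s ^ (q + 1) * d = 0} ≤ q + 1 := by
  have h1 := hq.one_lt
  set p := Polynomial.C a + Polynomial.C b * Polynomial.X + Polynomial.C c * Polynomial.X ^ q +
    Polynomial.C d * Polynomial.X ^ (q + 1) with hp
  have hdeg : p.natDegree ≤ q + 1 := by
    rw [hp]
    compute_degree
  have h0 : p ≠ 0 := by
    intro h
    have := congrArg (Polynomial.coeff · (q + 1)) h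
    simp [hp, Polynomial.coeff_C, Polynomial.coeff_X_pow, hq.ne_zero,
      hd] at this
  refine le_trans (card_le_card ?_) ((card_filter_eval_eq_zero_le h0).trans hdeg)
  refine monotone_filter_right _ fun s _ hs => ?_
  simp only [hp, Polynomial.eval_add, Polynomial.eval_mul, Polynomial.eval_pow,
    Polynomial.eval_C, Polynomial.eval_X]
  linear_combination hs

open Finset in
open scoped Classical in
lemma card_conjDet_eq_zero_le (hq : IsPrimePow q) (hF : Fintype.card F = q ^ 2)
    {Q : QuadraticForm F (Fin 5 → F)} {e₁ e₂ : Fin 5 → F} (he : SpanIsotropicLine q e₁ e₂)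
    (hβ : LinearIndependent F ![Q.polarBilin e₁, Q.polarBilin e₂])
    (hker : ∀ x, herm q x e₁ = 0 → herm q x e₂ = 0 →
      Q.polarBilin e₁ x = 0 ∧ Q.polarBilin e₂ x = 0) :
    #{x | ¬ (herm q x e₁ = 0 ∧ herm q x e₂ = 0) ∧ conjDet q Q e₁ e₂ x = 0} + (q + 1) * q ^ 6 ≤
      (q + 1) * q ^ 8 := by
  obtain ⟨y, hy⟩ := exists_conjDet_ne_zero hq hF he hβ hker
  set w := herm q y e₂ • e₁ + (-herm q y e₁) • e₂ with hw
  have hw0 : w ≠ 0 := fun h => by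
    have := LinearIndependent.pair_iff.1 he.1 _ _ h
    exact hy (by simp [conjDet, this.1, neg_eq_zero.1 this.2])
  have h1 := card_mul_card_filter_eq_sum (fun s : F => s • y)
    (fun x => ¬ (herm q x e₁ = 0 ∧ herm q x e₂ = 0) ∧ conjDet q Q e₁ e₂ x = 0)
  have h2 (x) : #{s : F | ¬ (herm q (x + s • y) e₁ = 0 ∧ herm q (x + s • y) e₂ = 0) ∧
      conjDet q Q e₁ e₂ (x + s • y) = 0} ≤ if herm q x w ≠ 0 then q + 1 else 0 := by
    split_ifs with h
    · refine le_trans (card_le_card (monotone_filter_right _ fun s _ hs => ?_))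
        (card_filter_semilinear_le hq (conjDet q Q e₁ e₂ x)
          (Q.polarBilin e₁ y * herm q x e₂ - Q.polarBilin e₂ y * herm q x e₁)
          (Q.polarBilin e₁ x * herm q y e₂ - Q.polarBilin e₂ x * herm q y e₁) hy)
      rw [← hs.2]
      simp only [conjDet, herm_add_left hq hF, herm_smul_left, map_add, map_smul, smul_eq_mul]
      ring
    · rw [not_not, hw, map_add, map_smul, map_smul, smul_eq_mul, smul_eq_mul] at h
      obtain ⟨c, hc₁, hc₂⟩ : ∃ c, herm q x e₁ = c * herm q y e₁ ∧
          herm q x e₂ = c * herm q y e₂ := by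
        by_cases hy₁ : herm q y e₁ = 0
        · have hy₂ : herm q y e₂ ≠ 0 := fun hy₂ => hy (by simp [conjDet, hy₁, hy₂])
          refine ⟨herm q x e₂ / herm q y e₂, ?_, by field_simp⟩
          field_simp
          linear_combination h
        · refine ⟨herm q x e₁ / herm q y e₁, by field_simp, ?_⟩
          field_simp
          linear_combination -h
      have hcq := pow_q_pow_q hF c
      set t := c ^ q
      have hu := hker (x + (-t) • y)
        (by rw [herm_add_left hq hF, herm_smul_left, neg_pow_q hq hF, hcq, hc₁]; ring)
        (by rw [herm_add_left hq hF, herm_smul_left, neg_pow_q hq hF, hcq, hc₂]; ring)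
      simp only [map_add, map_smul, smul_eq_mul] at hu
      rw [Nat.le_zero, card_eq_zero]
      refine filter_false_of_mem fun s _ ⟨hs, hd⟩ => hs ?_
      simp only [herm_add_left hq hF, herm_smul_left, hc₁, hc₂, ← add_mul, ← hcq,
        ← add_pow_q hq hF]
      suffices t + s = 0 by simp [this, hq.ne_zero]
      refine pow_eq_zero_iff (Nat.succ_ne_zero q) |>.1 ((mul_eq_zero_iff_right hy).1 ?_)
      rw [← hd, pow_succ, add_pow_q hq hF, hcq]
      simp only [conjDet, herm_add_left hq hF, herm_smul_left, map_add, map_smul, smul_eq_mul]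
      linear_combination -((c + s ^ q) * herm q y e₂) * hu.1 + ((c + s ^ q) * herm q y e₁) * hu.2
        - (Q.polarBilin e₁ x + s * Q.polarBilin e₁ y) * hc₂
        + (Q.polarBilin e₂ x + s * Q.polarBilin e₂ y) * hc₁
  have h3 := sum_le_sum fun x (_ : x ∈ univ) => h2 x
  have h4 := card_filter_add_card_filter_not (s := (univ : Finset (Fin 5 → F)))
    (fun x => herm q x w = 0)
  rw [← h1, hF, ← sum_filter, sum_const, smul_eq_mul] at h3
  rw [card_conj_eq_zero hq hF hw0, card_univ, Fintype.card_fun, hF, Fintype.card_fin] at h4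
  refine le_of_mul_le_mul_left (a := q ^ 2) ?_ (Nat.pow_pos hq.pos)
  have h5 := congrArg (· * (q + 1)) h4
  simp only [ne_eq] at h3 h5
  linarith

open Finset in
open scoped Classical in
lemma card_isotropic_quadric_le_of_ker_le (hq : IsPrimePow q)
    (hF : Fintype.card F = q ^ 2)
    {Q : QuadraticForm F (Fin 5 → F)} {e₁ e₂ : Fin 5 → F} (he : SpanCommonLine q Q e₁ e₂)
    (hβ : LinearIndependent F ![Q.polarBilin e₁, Q.polarBilin e₂])
    (hker : ∀ x, herm q x e₁ = 0 → herm q x e₂ = 0 →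
      Q.polarBilin e₁ x = 0 ∧ Q.polarBilin e₂ x = 0) :
    #{x | herm q x x = 0 ∧ Q x = 0} + 2 * q ^ 5 + 2 * q ^ 2 ≤ 2 * q ^ 7 + 2 * q ^ 4 + 1 := by
  have hmain := mul_card_isotropic_quadric_le hq hF he
  have h2 := card_conjDet_eq_zero_le hq hF he.1 hβ hker
  have hγ : #{x | herm q x e₁ = 0 ∧ herm q x e₂ = 0} = q ^ 6 := by
    rw [← card_filter_eq_zero_and hq hF (linearIndependent_herm_pair hq hF he.1.1)]
    simp only [herm_eq_zero_comm hq hF (x := e₁), herm_eq_zero_comm hq hF (x := e₂)]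
  have hβγ (x) (hx : Q.polarBilin e₁ x = 0 ∧ Q.polarBilin e₂ x = 0) :
      herm q x e₁ = 0 ∧ herm q x e₂ = 0 := by
    have := eq_of_subset_of_card_le (monotone_filter_right univ
      fun x _ (hx : herm q x e₁ = 0 ∧ herm q x e₂ = 0) => hker x hx.1 hx.2)
      (hγ.trans (card_filter_eq_zero_and hq hF hβ).symm).ge
    have hx' := (mem_filter_univ (p := fun x =>
      Q.polarBilin e₁ x = 0 ∧ Q.polarBilin e₂ x = 0) x).2 hx
    rw [← this] at hx'
    exact (mem_filter_univ x).1 hx'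
  rw [filter_false_of_mem (p := fun x => ¬ (herm q x e₁ = 0 ∧ herm q x e₂ = 0) ∧
    (Q.polarBilin e₁ x = 0 ∧ Q.polarBilin e₂ x = 0) ∧ Q x = 0)
    fun x _ hx => hx.1 (hβγ x hx.2.1), card_empty] at hmain
  set N₁ := #{x | conjDet q Q e₁ e₂ x ≠ 0} with hN₁
  set N₂ := #{x | ¬ (herm q x e₁ = 0 ∧ herm q x e₂ = 0) ∧ conjDet q Q e₁ e₂ x = 0} with hN₂
  have h3 := Nat.mul_le_mul_left (q ^ 2) (card_le_card (monotone_filter_right univ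
    fun x _ (hx : ¬ (herm q x e₁ = 0 ∧ herm q x e₂ = 0) ∧ conjDet q Q e₁ e₂ x = 0 ∧
      ¬ (Q.polarBilin e₁ x = 0 ∧ Q.polarBilin e₂ x = 0)) => And.intro hx.1 hx.2.1))
  have h1 : N₁ + N₂ + q ^ 6 = q ^ 10 := by
    have h4 := card_filter_add_card_filter_not (s := (univ : Finset (Fin 5 → F)))
      (fun x => herm q x e₁ = 0 ∧ herm q x e₂ = 0)
    have h5 := card_filter_add_card_filter_not
      (s := ({x | ¬ (herm q x e₁ = 0 ∧ herm q x e₂ = 0)} : Finset (Fin 5 → F)))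
      (fun x => conjDet q Q e₁ e₂ x = 0)
    have h6 (x) : ¬ (herm q x e₁ = 0 ∧ herm q x e₂ = 0) ∧ ¬ conjDet q Q e₁ e₂ x = 0 ↔
        conjDet q Q e₁ e₂ x ≠ 0 :=
      and_iff_right_of_imp fun h h' => h (by simp [conjDet, h'.1, h'.2])
    rw [filter_filter, filter_filter, filter_congr fun x _ => h6 x] at h5
    rw [hγ, card_univ, Fintype.card_fun, hF, Fintype.card_fin, ← pow_mul] at h4
    change _ = q ^ (2 * 5)
    omega
  refine le_of_mul_le_mul_left (a := q ^ 4) ?_ (Nat.pow_pos hq.pos)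
  obtain ⟨m, hm⟩ := Nat.exists_eq_add_of_lt hq.pos
  have h2' := Nat.mul_le_mul_left (q * m) h2
  rw [← hN₂] at h3
  zify at *
  rw [show (m : ℤ) = q - 1 by rw [hm]; ring] at h2'
  have h1' : (q : ℤ) * (N₁ + N₂ + q ^ 6) = q * q ^ 10 := by rw [h1]
  linarith [sq_nonneg ((q : ℤ) ^ 4 - q ^ 2)]

end QuadricThroughLine

section Cubic

variable {F : Type} [Field F]

/-- A quadratic form vanishing on a hyperplane is a product of linear forms. -/
lemma exists_eq_mul_of_ker {V : Type} [AddCommGroup V] [Module F V] (Q : QuadraticForm F V)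
    {φ : V →ₗ[F] F} (hφ : φ ≠ 0) (hQ : ∀ x, φ x = 0 → Q x = 0) :
    ∃ ψ : V →ₗ[F] F, ∀ x, Q x = φ x * ψ x := by
  obtain ⟨v, hv⟩ := LinearMap.surjective hφ 1
  refine ⟨Q.polarBilin v ∘ₗ (LinearMap.id - φ.smulRight v) + Q v • φ, fun x => ?_⟩
  have h0 := hQ (x - φ x • v) (by simp [hv])
  have h := quadraticForm_add_smul Q (x - φ x • v) v (φ x)
  rw [sub_add_cancel, h0] at h
  rw [h, QuadraticMap.polar_comm]
  simp
  ring

lemma eval_smul_of_isHomogeneous {σ : Type} {G : MvPolynomial σ F} {n : ℕ}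
    (hG : G.IsHomogeneous n) (c : F) (x : σ → F) : eval (c • x) G = c ^ n * eval x G := by
  rw [eval_eq, eval_eq, Finset.mul_sum]
  refine Finset.sum_congr rfl fun d hd => ?_
  have := hG.degree_eq_sum_deg_support hd
  simp_rw [Pi.smul_apply, smul_eq_mul, mul_pow, Finset.prod_mul_distrib, Finset.prod_pow_eq_pow_sum]
  rw [this]
  ring

/-- The values of a cubic form at a point and at its projection to a hyperplane differ by a
multiple of the linear form defining that hyperplane. -/
lemma exists_eval_eq_add_mul {σ : Type} [Fintype σ] {G : MvPolynomial σ F}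
    (hG : G.IsHomogeneous 3) (φ : (σ → F) →ₗ[F] F) (v : σ → F) :
    ∃ R : QuadraticForm F (σ → F), ∀ x, eval x G = eval (x - φ x • v) G + φ x * R x := by
  have key (d : σ →₀ ℕ) : ∃ R : QuadraticForm F (σ → F), d ∈ G.support → ∀ x,
      eval x (monomial d (coeff d G)) =
        eval (x - φ x • v) (monomial d (coeff d G)) + φ x * R x := by
    by_cases hd : d ∈ G.support
    · obtain ⟨i, j, k, hijk⟩ : ∃ i j k, d.toMultiset = {i, j, k} := by
        rw [← Multiset.card_eq_three, Finsupp.card_toMultiset]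
        exact (hG.degree_eq_sum_deg_support hd).symm
      classical
      have hd' : d = .single i 1 + .single j 1 + .single k 1 := by
        refine Multiset.toFinsupp.symm.injective ?_
        change Finsupp.toMultiset _ = Finsupp.toMultiset _
        rw [hijk]
        simp
      refine ⟨coeff d G • (v i • QuadraticMap.linMulLin (LinearMap.proj j) (LinearMap.proj k) +
        v j • QuadraticMap.linMulLin (LinearMap.proj i - v i • φ) (LinearMap.proj k) +
        v k • QuadraticMap.linMulLin (LinearMap.proj i - v i • φ)
          (LinearMap.proj j - v j • φ)), fun _ x => ?_⟩
      have hev (y : σ → F) : eval y (monomial d (coeff d G)) = coeff d G * (y i * y j * y k) := by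
        rw [eval_monomial, hd', Finsupp.prod_add_index' (by simp) (by simp [pow_add]),
          Finsupp.prod_add_index' (by simp) (by simp [pow_add])]
        simp
      rw [hev, hev]
      simp
      ring
    · exact ⟨0, fun h => absurd h hd⟩
  choose R hR using key
  refine ⟨∑ d ∈ G.support, R d, fun x => ?_⟩
  have hsum (y : σ → F) : eval y G = ∑ d ∈ G.support, eval y (monomial d (coeff d G)) := by
    rw [← map_sum, ← G.as_sum]
  rw [hsum, hsum, sum_apply, Finset.mul_sum, ← Finset.sum_add_distrib]
  exact Finset.sum_congr rfl fun d hd => hR d hd x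

/-- A cubic form vanishing on a hyperplane splits off a linear factor. -/
lemma exists_eval_eq_mul {G : MvPolynomial (Fin 5) F} (hG : G.IsHomogeneous 3)
    {S : Set (P4 F)} (hS : IsHyperplane F S) (hSG : S ⊆ VG G) :
    ∃ φ : (Fin 5 → F) →ₗ[F] F, φ ≠ 0 ∧ ∃ R : QuadraticForm F (Fin 5 → F),
      ∀ x, eval x G = φ x * R x := by
  obtain ⟨W, hW, rfl⟩ := hS
  obtain ⟨φ, hφ, hWφ⟩ := Submodule.exists_le_ker_of_lt_top W (lt_top_iff_ne_top.2 fun h => by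
    rw [h, finrank_top, Module.finrank_fin_fun] at hW
    omega)
  have hker : W = LinearMap.ker φ := by
    refine Submodule.eq_of_le_of_finrank_eq hWφ ?_
    have := Module.Dual.finrank_ker_add_one_of_ne_zero (f := φ) hφ
    rw [Module.finrank_fin_fun] at this
    omega
  obtain ⟨v, hv⟩ := LinearMap.surjective hφ 1
  obtain ⟨R, hR⟩ := exists_eval_eq_add_mul hG φ v
  refine ⟨φ, hφ, R, fun x => ?_⟩
  rw [hR, add_eq_right]
  set w := x - φ x • v with hw_def
  have hw : w ∈ W := by simp [hker, hw_def, hv]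
  by_cases h0 : w = 0
  · have := eval_smul_of_isHomogeneous hG 0 0
    simpa [h0] using this
  · have hmem : Projectivization.mk F w h0 ∈ {x : P4 F | x.submodule ≤ W} := by
      rw [Set.mem_ofPred_eq, Projectivization.submodule_mk, Submodule.span_singleton_le_iff_mem]
      exact hw
    have hP : eval (Projectivization.mk F w h0).rep G = 0 := hSG hmem
    obtain ⟨a, ha⟩ := Projectivization.exists_smul_eq_mk_rep F w h0
    rw [← ha, Units.smul_def, eval_smul_of_isHomogeneous hG] at hP
    simpa using hP

variable [Fintype F] {q : ℕ}

open Finset in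
open scoped Classical in
lemma card_isotropic_quadric_le (hq : IsPrimePow q) (hq3 : 3 ≤ q)
    (hF : Fintype.card F = q ^ 2) {Q : QuadraticForm F (Fin 5 → F)}
    (hQ : ∀ φ : (Fin 5 → F) →ₗ[F] F, φ ≠ 0 → ∃ x, φ x = 0 ∧ Q x ≠ 0) :
    #{x | herm q x x = 0 ∧ Q x = 0} + 2 * q ^ 5 + 2 * q ^ 2 ≤ 2 * q ^ 7 + 2 * q ^ 4 + 1 := by
  by_cases hl : ∃ e₁ e₂, SpanCommonLine q Q e₁ e₂
  · obtain ⟨e₁, e₂, he⟩ := hl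
    by_cases hβ : LinearIndependent F ![Q.polarBilin e₁, Q.polarBilin e₂]
    · by_cases hker : ∀ x, herm q x e₁ = 0 → herm q x e₂ = 0 →
          Q.polarBilin e₁ x = 0 ∧ Q.polarBilin e₂ x = 0
      · exact card_isotropic_quadric_le_of_ker_le hq hF he hβ hker
      · push Not at hker
        obtain ⟨x, h₁, h₂, h₀⟩ := hker
        exact card_isotropic_quadric_le_of_not_ker_le hq hq3 hF he hβ h₁ h₂ fun h => h₀ h.1 h.2
    · exact card_isotropic_quadric_le_of_dependent hq hq3 hF he hQ hβ
  · have h := card_isotropic_quadric_le_of_no_line hq hF Q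
      fun x y hxy hx hy h => hl ⟨x, y, hxy, hx, hy, h⟩
    have h4 : q ^ 4 = q ^ 2 * q ^ 2 := by ring
    have h2 : 2 * q ^ 2 ≤ q ^ 2 * q ^ 2 := Nat.mul_le_mul_right _ (by nlinarith)
    omega

open Finset in
open scoped Classical in
/-- Points of the Hermitian threefold on a quadric and off a hyperplane. -/
lemma card_isotropic_quadric_diff_le (hq : IsPrimePow q) (hq3 : 3 ≤ q)
    (hF : Fintype.card F = q ^ 2) {Q : QuadraticForm F (Fin 5 → F)} (hQ : ∃ x, Q x ≠ 0)
    (φ : (Fin 5 → F) →ₗ[F] F) :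
    #{x | Q x = 0 ∧ φ x ≠ 0 ∧ herm q x x = 0} + 2 * q ^ 5 + 2 * q ^ 2 ≤
      2 * q ^ 7 + 2 * q ^ 4 := by
  by_cases h : ∀ ψ : (Fin 5 → F) →ₗ[F] F, ψ ≠ 0 → ∃ x, ψ x = 0 ∧ Q x ≠ 0
  · have h1 := card_isotropic_quadric_le hq hq3 hF h
    have h2 : #{x | Q x = 0 ∧ φ x ≠ 0 ∧ herm q x x = 0} < #{x | herm q x x = 0 ∧ Q x = 0} := by
      refine card_lt_card ((ssubset_iff_of_subset
        (monotone_filter_right _ fun x _ hx => ⟨hx.2.2, hx.1⟩)).2 ⟨0, ?_, ?_⟩)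
      · simp
      · simp
    omega
  · push Not at h
    obtain ⟨ψ₁, h₁, hψ⟩ := h
    obtain ⟨ψ₂, h₂⟩ := exists_eq_mul_of_ker Q h₁ hψ
    have h₂' : ψ₂ ≠ 0 := by
      rintro rfl
      obtain ⟨x, hx⟩ := hQ
      exact hx (by simp [h₂])
    have hd₁ := card_isotropic_hyperplane_diff_le hq hF h₁ φ
    have hd₂ := card_isotropic_hyperplane_diff_le hq hF h₂' φ
    have hu : #{x | Q x = 0 ∧ φ x ≠ 0 ∧ herm q x x = 0} ≤
        #{x | ψ₁ x = 0 ∧ φ x ≠ 0 ∧ herm q x x = 0} +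
          #{x | ψ₂ x = 0 ∧ φ x ≠ 0 ∧ herm q x x = 0} := by
      refine le_trans (card_le_card fun x hx => ?_) (card_union_le _ _)
      simp only [mem_union, mem_filter_univ] at hx ⊢
      rw [h₂, mul_eq_zero] at hx
      tauto
    omega

open Finset in
open scoped Classical in
lemma card_isotropic_cubic_le (hq : IsPrimePow q) (hq3 : 3 ≤ q)
    (hF : Fintype.card F = q ^ 2) {Q : QuadraticForm F (Fin 5 → F)} (hQ : ∃ x, Q x ≠ 0)
    {φ : (Fin 5 → F) →ₗ[F] F} (hφ : φ ≠ 0) :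
    #{x | x ≠ 0 ∧ φ x * Q x = 0 ∧ herm q x x = 0} ≤
      (3 * (q ^ 5 + q ^ 2) + q ^ 3 + 1) * (q ^ 2 - 1) := by
  have h₁ := card_isotropic_hyperplane_le hq hF hφ
  have h₂ := card_isotropic_quadric_diff_le hq hq3 hF hQ φ
  have h₃ : #{x | x ≠ 0 ∧ φ x * Q x = 0 ∧ herm q x x = 0} <
      #{x | φ x * Q x = 0 ∧ herm q x x = 0} :=
    card_lt_card ((ssubset_iff_of_subset
      (monotone_filter_right _ fun x _ hx => hx.2)).2 ⟨0, by simp, by simp⟩)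
  have h₄ : #{x | φ x * Q x = 0 ∧ herm q x x = 0} ≤
      #{x | φ x = 0 ∧ herm q x x = 0} + #{x | Q x = 0 ∧ φ x ≠ 0 ∧ herm q x x = 0} := by
    refine le_trans (card_le_card fun x hx => ?_) (card_union_le _ _)
    simp only [mem_union, mem_filter_univ, mul_eq_zero] at hx ⊢
    tauto
  have h₅ : 1 ≤ q ^ 2 := Nat.pow_pos hq.pos
  zify [h₅] at *
  linarith

open Finset in
open scoped Classical in
/-- Passing from projective points to their nonzero representatives. -/
lemma ncard_mul_le (hF : Fintype.card F = q ^ 2) {n : ℕ} {G : MvPolynomial (Fin 5) F}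
    (hG : G.IsHomogeneous n) :
    (VG G ∩ hermV3 q F).ncard * (q ^ 2 - 1) ≤
      #{x | x ≠ 0 ∧ eval x G = 0 ∧ herm q x x = 0} := by
  have : Finite (P4 F) := Projectivization.finite_of_finite ..
  rw [← hF, ← Fintype.card_units, ← Nat.card_eq_fintype_card, ← Nat.card_coe_set_eq,
    ← Nat.card_prod,
    ← Set.ncard_coe_finset, ← Nat.card_coe_set_eq]
  refine Nat.card_le_card_of_injective (fun P => ⟨P.2 • P.1.1.rep, ?_⟩) ?_
  · obtain ⟨⟨P, hP⟩, c⟩ := P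
    obtain ⟨h₁, h₂⟩ := hP
    have h₁ : eval P.rep G = 0 := h₁
    have h₂ : herm q P.rep P.rep = 0 := (herm_self _).trans h₂
    have := P.rep_nonzero
    simp only [mem_coe, mem_filter_univ, Units.smul_def, herm_smul_smul,
      eval_smul_of_isHomogeneous hG, h₁, h₂]
    simp [this]
  · rintro ⟨⟨P, hP⟩, c⟩ ⟨⟨P', hP'⟩, c'⟩ h
    have h : c • P.rep = c' • P'.rep := congrArg Subtype.val h
    obtain rfl : P = P' := by
      rw [← P.mk_rep, ← P'.mk_rep, Projectivization.mk_eq_mk_iff]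
      exact ⟨c⁻¹ * c', by rw [mul_smul, ← h, inv_smul_smul]⟩
    have : c = c' := by
      obtain ⟨i, hi⟩ := Function.ne_iff.1 P.rep_nonzero
      exact Units.ext (mul_right_cancel₀ hi (congrFun h i))
    rw [this]

end Cubic

theorem stmt15 (q : ℕ) (hq : IsPrimePow q) (hq3 : 3 ≤ q)
    (F : Type) [Field F] [Fintype F] (hF : Fintype.card F = q ^ 2)
    (G : MvPolynomial (Fin 5) F) (hG : G ≠ 0) (hGd : G.IsHomogeneous 3)
    (hhyp : ∃ S : Set (P4 F), IsHyperplane F S ∧ S ⊆ VG G) :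
    (VG G ∩ hermV3 q F).ncard ≤ 3 * (q ^ 5 + q ^ 2) + q ^ 3 + 1 := by
  classical
  obtain ⟨S, hS, hSG⟩ := hhyp
  obtain ⟨φ, hφ, R, hR⟩ := exists_eval_eq_mul hGd hS hSG
  have hq2 : 3 ≤ q ^ 2 := by nlinarith
  have hR0 : ∃ x, R x ≠ 0 := by
    by_contra! h
    refine hG (hGd.eq_zero_of_forall_eval_eq_zero_of_le_card (fun x => by simp [hR, h]) ?_)
    rw [Cardinal.mk_fintype, hF]
    exact_mod_cast hq2
  have h₁ := ncard_mul_le hF hGd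
  have h₂ := card_isotropic_cubic_le hq hq3 hF hR0 hφ
  simp_rw [hR] at h₁
  exact Nat.le_of_mul_le_mul_right (h₁.trans (by convert h₂)) (by omega)
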